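/- arXiv:1409.6229 — 4 statements merged into one kernel-verified Lean document; each statement's English description precedes it below -/
import Mathlib

section
/- Let λ ∈ ℝ \ {0} and A > 0, and let q : (0,A) → ℂ be continuous with q(x) = (−λ²−1/4)/x² + q₀(x), where ∫₀^{A/2} t·|q₀(t)| dt < ∞. Then for every μ ∈ ℂ there exist twice continuously differentiable functions S₁, S₂ : (0,A) → ℂ, both satisfying −u''(x) + q(x)·u(x) = −μ²·u(x) on (0,A), such that S₁(x)·x^{−1/2+iλ} → 1 and 2iλ·S₂(x)·x^{−1/2−iλ} → 1 as x → 0⁺ (principal-branch complex powers), and whose Wronskian satisfies S₁(x)·S₂'(x) − S₁'(x)·S₂(x) = 1 for all x ∈ (0,A). -/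
open Filter MeasureTheory Set
open scoped Topology Nat

section LinearODE

variable {𝕜 E : Type*} [NontriviallyNormedField 𝕜] [NormedAddCommGroup E] [NormedSpace ℝ E]
  [NormedSpace 𝕜 E]

/-- The terms of the Picard (Peano–Baker) series of `Y' = M Y`, `Y 0 = y₀`. -/
noncomputable def picardTerm (M : ℝ → E →L[𝕜] E) (y₀ : E) : ℕ → ℝ → E
  | 0, _ => y₀
  | n + 1, x => ∫ t in (0 : ℝ)..x, M t (picardTerm M y₀ n t)

theorem continuousOn_primitive_Ioo {F : Type*} [NormedAddCommGroup F] [NormedSpace ℝ F]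
    {f : ℝ → F} {A : ℝ}
    (hint : ∀ x ∈ Ioo 0 A, IntervalIntegrable f volume 0 x) {b : ℝ} (hb : b ∈ Ioo 0 A) :
    ContinuousOn (fun x => ∫ t in (0 : ℝ)..x, f t) (Icc 0 b) := by
  have h := intervalIntegral.continuousOn_primitive_interval' (hint b hb)
    (left_mem_uIcc (a := (0 : ℝ)) (b := b))
  rwa [uIcc_of_le hb.1.le] at h

theorem hasDerivAt_primitive_Ioo {F : Type*} [NormedAddCommGroup F] [NormedSpace ℝ F]
    [CompleteSpace F] {f : ℝ → F} {A : ℝ} (hf : ContinuousOn f (Ioo 0 A))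
    (hint : ∀ x ∈ Ioo 0 A, IntervalIntegrable f volume 0 x) {x : ℝ} (hx : x ∈ Ioo 0 A) :
    HasDerivAt (fun x => ∫ t in (0 : ℝ)..x, f t) (f x) x :=
  intervalIntegral.integral_hasDerivAt_right (hint x hx)
    (hf.stronglyMeasurableAtFilter isOpen_Ioo x hx) (hf.continuousAt (isOpen_Ioo.mem_nhds hx))

theorem integral_mul_pow_primitive {m : ℝ → ℝ} {A : ℝ} (hm : ContinuousOn m (Ioo 0 A))
    (hint : ∀ x ∈ Ioo 0 A, IntervalIntegrable m volume 0 x) (n : ℕ) {x : ℝ}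
    (hx : x ∈ Ioo 0 A) :
    IntervalIntegrable (fun t => m t * ((∫ s in (0 : ℝ)..t, m s) ^ n / n !)) volume 0 x ∧
    ∫ t in (0 : ℝ)..x, m t * ((∫ s in (0 : ℝ)..t, m s) ^ n / n !)
      = (∫ s in (0 : ℝ)..x, m s) ^ (n + 1) / (n + 1)! := by
  have hc := continuousOn_primitive_Ioo hint hx
  have hi : IntervalIntegrable (fun t => m t * ((∫ s in (0 : ℝ)..t, m s) ^ n / n !))
      volume 0 x := by
    refine (hint x hx).mul_continuousOn ?_
    rw [uIcc_of_le hx.1.le]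
    exact (hc.pow n).div_const _
  refine ⟨hi, ?_⟩
  have h := intervalIntegral.integral_eq_sub_of_hasDerivAt_of_le hx.1.le
    ((hc.pow (n + 1)).div_const ((n + 1)! : ℝ)) (fun t ht => ?_) hi
  · rw [h]
    simp
  · convert! ((hasDerivAt_primitive_Ioo hm hint ⟨ht.1, ht.2.trans hx.2⟩).pow (n + 1)).div_const
      ((n + 1)! : ℝ) using 1
    rw [Nat.factorial_succ]
    push_cast
    have : (n ! : ℝ) ≠ 0 := by positivity
    field_simp

variable {M : ℝ → E →L[𝕜] E} {A : ℝ}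

theorem continuousOn_and_norm_picardTerm_le [CompleteSpace E] (hM : ContinuousOn M (Ioo 0 A))
    (hint : ∀ x ∈ Ioo 0 A, IntervalIntegrable (fun t => ‖M t‖) volume 0 x) (y₀ : E) (n : ℕ) :
    ContinuousOn (picardTerm M y₀ n) (Ioo 0 A) ∧
    (∀ x ∈ Ioo 0 A, ‖picardTerm M y₀ n x‖ ≤ ‖y₀‖ * ((∫ s in (0 : ℝ)..x, ‖M s‖) ^ n / n !)) ∧
    ∀ x ∈ Ioo 0 A, HasDerivAt (picardTerm M y₀ (n + 1)) (M x (picardTerm M y₀ n x)) x := by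
  induction n with
  | zero =>
    have hc : ContinuousOn (picardTerm M y₀ 0) (Ioo 0 A) := continuousOn_const
    refine ⟨hc, fun x _ => by simp [picardTerm], fun x hx => ?_⟩
    refine hasDerivAt_primitive_Ioo (hM.clm_apply hc) (fun x hx => ?_) hx
    refine ((hint x hx).mul_const ‖y₀‖).mono_fun' ?_ ?_
    · rw [uIoc_of_le hx.1.le]
      exact ((hM.clm_apply hc).mono
        (fun t ht => ⟨ht.1, ht.2.trans_lt hx.2⟩)).aestronglyMeasurable measurableSet_Ioc
    · exact ae_of_all _ fun t => (M t).le_opNorm y₀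
  | succ n ih =>
    obtain ⟨-, hb, hd⟩ := ih
    have hc : ContinuousOn (picardTerm M y₀ (n + 1)) (Ioo 0 A) :=
      fun x hx => (hd x hx).continuousAt.continuousWithinAt
    have hnorm : ContinuousOn (fun t => ‖M t‖) (Ioo 0 A) := hM.norm
    have hb' : ∀ x ∈ Ioo 0 A, ‖picardTerm M y₀ (n + 1) x‖
        ≤ ‖y₀‖ * ((∫ s in (0 : ℝ)..x, ‖M s‖) ^ (n + 1) / (n + 1)!) := by
      intro x hx
      obtain ⟨hi, he⟩ := integral_mul_pow_primitive hnorm hint n hx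
      rw [← he, ← intervalIntegral.integral_const_mul]
      refine intervalIntegral.norm_integral_le_of_norm_le hx.1.le
        (ae_of_all _ fun t ht => ?_) (hi.const_mul _)
      calc ‖M t (picardTerm M y₀ n t)‖ ≤ ‖M t‖ * ‖picardTerm M y₀ n t‖ := (M t).le_opNorm _
        _ ≤ ‖M t‖ * (‖y₀‖ * ((∫ s in (0 : ℝ)..t, ‖M s‖) ^ n / n !)) := by
          gcongr
          exact hb t ⟨ht.1, ht.2.trans_lt hx.2⟩
        _ = _ := by ring
    refine ⟨hc, hb', fun x hx => ?_⟩
    refine hasDerivAt_primitive_Ioo (hM.clm_apply hc) (fun x hx => ?_) hx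
    refine ((integral_mul_pow_primitive hnorm hint (n + 1) hx).1.const_mul ‖y₀‖).mono_fun' ?_ ?_
    · rw [uIoc_of_le hx.1.le]
      exact ((hM.clm_apply hc).mono
        (fun t ht => ⟨ht.1, ht.2.trans_lt hx.2⟩)).aestronglyMeasurable measurableSet_Ioc
    · rw [uIoc_of_le hx.1.le]
      refine (ae_restrict_iff' measurableSet_Ioc).2 (ae_of_all _ fun t ht => ?_)
      calc ‖M t (picardTerm M y₀ (n + 1) t)‖
          ≤ ‖M t‖ * ‖picardTerm M y₀ (n + 1) t‖ := (M t).le_opNorm _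
        _ ≤ ‖M t‖ * (‖y₀‖ * ((∫ s in (0 : ℝ)..t, ‖M s‖) ^ (n + 1) / (n + 1)!)) := by
          gcongr
          exact hb' t ⟨ht.1, ht.2.trans_lt hx.2⟩
        _ = _ := by ring

/-- A linear ODE on `(0, A)` whose continuous coefficient is integrable at `0` has a solution
with any prescribed limit at `0`. -/
theorem exists_hasDerivAt_linear_tendsto [CompleteSpace E] (hM : ContinuousOn M (Ioo 0 A))
    (hA : 0 < A) (hint : ∀ x ∈ Ioo 0 A, IntervalIntegrable (fun t => ‖M t‖) volume 0 x)
    (y₀ : E) :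
    ∃ Y : ℝ → E, (∀ x ∈ Ioo 0 A, HasDerivAt Y (M x (Y x)) x) ∧ Tendsto Y (𝓝[>] 0) (𝓝 y₀) := by
  set G : ℝ → ℝ := fun x => ∫ s in (0 : ℝ)..x, ‖M s‖ with hG
  have hP := continuousOn_and_norm_picardTerm_le hM hint y₀
  have hG0 : ∀ x ∈ Ioo 0 A, 0 ≤ G x := fun x hx =>
    intervalIntegral.integral_nonneg hx.1.le fun _ _ => norm_nonneg _
  have hmono : ∀ b ∈ Ioo 0 A, ∀ x ∈ Ioc 0 b, G x ≤ G b := fun b hb x hx =>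
    intervalIntegral.integral_mono_interval le_rfl hx.1.le hx.2
      (ae_of_all _ fun _ => norm_nonneg _) (hint b hb)
  have hle : ∀ b ∈ Ioo 0 A, ∀ x ∈ Ioc 0 b, ∀ n,
      ‖picardTerm M y₀ n x‖ ≤ ‖y₀‖ * (G b ^ n / n !) := by
    intro b hb x hx n
    have hxA : x ∈ Ioo 0 A := ⟨hx.1, hx.2.trans_lt hb.2⟩
    refine ((hP n).2.1 x hxA).trans ?_
    have := hG0 x hxA
    have := hmono b hb x hx
    gcongr
  have hsum : ∀ b, Summable fun n : ℕ => ‖y₀‖ * (G b ^ n / n !) := fun b =>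
    (Real.summable_pow_div_factorial (G b)).mul_left _
  have hPsum : ∀ x ∈ Ioo 0 A, Summable fun n => picardTerm M y₀ n x := fun x hx =>
    .of_norm_bounded (hsum x) (hle x hx x ⟨hx.1, le_rfl⟩)
  refine ⟨fun x => y₀ + ∑' n, picardTerm M y₀ (n + 1) x, fun x hx => ?_, ?_⟩
  · obtain ⟨a, ha0, hax⟩ := exists_between hx.1
    obtain ⟨b, hxb, hbA⟩ := exists_between hx.2
    have hb : b ∈ Ioo 0 A := ⟨hx.1.trans hxb, hbA⟩
    obtain ⟨C, hC⟩ := isCompact_Icc.exists_bound_of_continuousOn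
      (hM.mono fun t (ht : t ∈ Icc a b) => ⟨ha0.trans_le ht.1, ht.2.trans_lt hbA⟩)
    have hd := hasDerivAt_tsum_of_isPreconnected (g := fun n => picardTerm M y₀ (n + 1))
      (g' := fun n t => M t (picardTerm M y₀ n t)) (t := Ioo a b) ((hsum b).mul_left C)
      isOpen_Ioo isPreconnected_Ioo
      (fun n t ht => (hP n).2.2 t ⟨ha0.trans ht.1, ht.2.trans hbA⟩)
      (fun n t ht => (M t).le_of_opNorm_le_of_le (hC t ⟨ht.1.le, ht.2.le⟩)
        (hle b hb t ⟨ha0.trans ht.1, ht.2.le⟩ n))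
      ⟨hax, hxb⟩ ((summable_nat_add_iff 1).2 (hPsum x hx)) ⟨hax, hxb⟩
    convert! hd.const_add y₀ using 1
    rw [← (M x).map_tsum (hPsum x hx), (hPsum x hx).tsum_eq_zero_add]
    rfl
  · obtain ⟨b, hb0, hbA⟩ := exists_between hA
    have hmem : Ioc 0 b ∈ 𝓝[>] (0 : ℝ) := Ioc_mem_nhdsGT hb0
    have hGlim : Tendsto G (𝓝[>] 0) (𝓝 0) := by
      have h := (continuousOn_primitive_Ioo hint ⟨hb0, hbA⟩) 0 ⟨le_rfl, hb0.le⟩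
      have h' := h.mono_left (nhdsWithin_mono 0 (Ioc_subset_Icc_self (a := (0 : ℝ)) (b := b)))
      rw [nhdsWithin_Ioc_eq_nhdsGT hb0] at h'
      simpa using h'
    have hlim := tendsto_tsum_of_dominated_convergence (𝓕 := 𝓝[>] (0 : ℝ))
      (f := fun x n => picardTerm M y₀ (n + 1) x) (g := fun _ => 0)
      ((summable_nat_add_iff 1).2 (hsum b)) (fun n => ?_) ?_
    · simpa using hlim.const_add y₀
    · refine squeeze_zero_norm' (a := fun x => ‖y₀‖ * (G x ^ (n + 1) / (n + 1)!)) ?_ ?_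
      · filter_upwards [hmem] with x hx
        exact (hP (n + 1)).2.1 x ⟨hx.1, hx.2.trans_lt hbA⟩
      · simpa using ((hGlim.pow (n + 1)).div_const ((n + 1)! : ℝ)).const_mul ‖y₀‖
    · filter_upwards [hmem] with x hx n
      exact hle b ⟨hb0, hbA⟩ x hx (n + 1)

end LinearODE

section Euler

theorem hasDerivAt_ofReal_cpow_const_div (s : ℂ) {x : ℝ} (hx : 0 < x) :
    HasDerivAt (fun y : ℝ => (y : ℂ) ^ s) (s * (x : ℂ) ^ s / x) x := by
  have hx' : (x : ℂ) ≠ 0 := by exact_mod_cast hx.ne'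
  have h := ((hasDerivAt_id (x : ℂ)).cpow_const (c := s) (Or.inl (by simpa using hx))).comp_ofReal
  convert! h using 1
  simp only [id]
  rw [Complex.cpow_sub _ _ hx', Complex.cpow_one]
  ring

theorem cpow_half_sub_mul_cpow_half_add (l : ℂ) {x : ℝ} (hx : 0 < x) :
    (x : ℂ) ^ (1 / 2 - l) * (x : ℂ) ^ (1 / 2 + l) = x := by
  rw [← Complex.cpow_add _ _ (by exact_mod_cast hx.ne')]
  norm_num

theorem intervalIntegrable_of_continuousOn_Ioo {f : ℝ → ℝ} {A c : ℝ}
    (hc : 0 < c) (hf : ContinuousOn f (Ioo 0 A)) (hi : IntegrableOn f (Ioo 0 c)) {x : ℝ}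
    (hx : x ∈ Ioo 0 A) : IntervalIntegrable f volume 0 x := by
  rw [intervalIntegrable_iff_integrableOn_Ioo_of_le hx.1.le]
  have h : IntegrableOn f (Icc c x) :=
    (hf.mono fun t ht => ⟨hc.trans_le ht.1, ht.2.trans_lt hx.2⟩).integrableOn_Icc
  refine (hi.union h).mono_set fun t ht => ?_
  by_cases htc : t < c
  · exact Or.inl ⟨ht.1, htc⟩
  · exact Or.inr ⟨not_lt.1 htc, ht.2.le⟩

/-- The first-order system obtained by variation of parameters, with respect to the basis
`x ^ (1/2 - iλ)`, `x ^ (1/2 + iλ) / (2iλ)` of solutions of the Euler equation, for the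
perturbation `r` of the potential. -/
theorem exists_variation_of_parameters {lam A : ℝ} (hA : 0 < A) {r : ℝ → ℂ}
    (hr : ContinuousOn r (Ioo 0 A))
    (hint : ∀ x ∈ Ioo 0 A, IntervalIntegrable (fun t => t * ‖r t‖) volume 0 x) (c a₀ b₀ : ℂ) :
    ∃ a b : ℝ → ℂ,
      (∀ x ∈ Ioo 0 A, HasDerivAt a (-(c * (x : ℂ) ^ (1 / 2 + Complex.I * lam) * r x) *
        (a x * (x : ℂ) ^ (1 / 2 - Complex.I * lam) +
          b x * (c * (x : ℂ) ^ (1 / 2 + Complex.I * lam)))) x) ∧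
      (∀ x ∈ Ioo 0 A, HasDerivAt b ((x : ℂ) ^ (1 / 2 - Complex.I * lam) * r x *
        (a x * (x : ℂ) ^ (1 / 2 - Complex.I * lam) +
          b x * (c * (x : ℂ) ^ (1 / 2 + Complex.I * lam)))) x) ∧
      Tendsto a (𝓝[>] 0) (𝓝 a₀) ∧ Tendsto b (𝓝[>] 0) (𝓝 b₀) := by
  set p : ℝ → ℂ := fun x => (x : ℂ) ^ (1 / 2 - Complex.I * lam) with hp
  set w : ℝ → ℂ := fun x => (x : ℂ) ^ (1 / 2 + Complex.I * lam) with hw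
  have hpc : ContinuousOn p (Ioo 0 A) := fun x hx =>
    (hasDerivAt_ofReal_cpow_const_div _ hx.1).continuousAt.continuousWithinAt
  have hwc : ContinuousOn w (Ioo 0 A) := fun x hx =>
    (hasDerivAt_ofReal_cpow_const_div _ hx.1).continuousAt.continuousWithinAt
  have hpn : ∀ x : ℝ, 0 < x → ‖p x‖ * ‖p x‖ = x := fun x hx => by
    simp only [hp, Complex.norm_cpow_eq_rpow_re_of_pos hx]
    rw [← Real.rpow_add hx]
    norm_num
  have hwn : ∀ x : ℝ, 0 < x → ‖w x‖ * ‖w x‖ = x := fun x hx => by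
    simp only [hw, Complex.norm_cpow_eq_rpow_re_of_pos hx]
    rw [← Real.rpow_add hx]
    norm_num
  have hpwn : ∀ x : ℝ, 0 < x → ‖p x‖ * ‖w x‖ = x := fun x hx => by
    rw [← norm_mul, hp, hw, cpow_half_sub_mul_cpow_half_add _ hx]
    simpa using hx.le
  let K₁ := (ContinuousLinearMap.inl ℂ ℂ ℂ).comp (ContinuousLinearMap.fst ℂ ℂ ℂ)
  let K₂ := (ContinuousLinearMap.inl ℂ ℂ ℂ).comp (ContinuousLinearMap.snd ℂ ℂ ℂ)
  let K₃ := (ContinuousLinearMap.inr ℂ ℂ ℂ).comp (ContinuousLinearMap.fst ℂ ℂ ℂ)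
  let K₄ := (ContinuousLinearMap.inr ℂ ℂ ℂ).comp (ContinuousLinearMap.snd ℂ ℂ ℂ)
  let M : ℝ → ℂ × ℂ →L[ℂ] ℂ × ℂ := fun x =>
    (-(c * (p x * w x) * r x)) • K₁ + (-(c * c * (w x * w x) * r x)) • K₂ +
      (p x * p x * r x) • K₃ + (c * (p x * w x) * r x) • K₄
  have hM : ContinuousOn M (Ioo 0 A) := by fun_prop
  have hMn : ∀ x ∈ Ioo 0 A, ‖M x‖ ≤
      (‖c‖ * ‖K₁‖ + ‖c‖ * ‖c‖ * ‖K₂‖ + ‖K₃‖ + ‖c‖ * ‖K₄‖) * (x * ‖r x‖) := by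
    intro x hx
    refine (norm_add₄_le).trans (le_of_eq ?_)
    simp only [norm_smul, norm_neg, norm_mul, hpn x hx.1, hwn x hx.1, hpwn x hx.1]
    ring
  obtain ⟨Y, hY, hY0⟩ := exists_hasDerivAt_linear_tendsto hM hA (fun x hx => by
    refine ((hint x hx).const_mul
      (‖c‖ * ‖K₁‖ + ‖c‖ * ‖c‖ * ‖K₂‖ + ‖K₃‖ + ‖c‖ * ‖K₄‖)).mono_fun' ?_ ?_
    · rw [uIoc_of_le hx.1.le]
      exact (hM.norm.mono
        (fun t ht => ⟨ht.1, ht.2.trans_lt hx.2⟩)).aestronglyMeasurable measurableSet_Ioc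
    · rw [uIoc_of_le hx.1.le]
      refine (ae_restrict_iff' measurableSet_Ioc).2 (ae_of_all _ fun t ht => ?_)
      simpa using hMn t ⟨ht.1, ht.2.trans_lt hx.2⟩) (a₀, b₀)
  refine ⟨fun x => (Y x).1, fun x => (Y x).2, fun x hx => ?_, fun x hx => ?_,
    (continuous_fst.tendsto _).comp hY0, (continuous_snd.tendsto _).comp hY0⟩
  · convert! (ContinuousLinearMap.fst ℝ ℂ ℂ).hasFDerivAt.comp_hasDerivAt x (hY x hx) using 1
    simp [M, K₁, K₂, K₃, K₄, p, w]
    ring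
  · convert! (ContinuousLinearMap.snd ℝ ℂ ℂ).hasFDerivAt.comp_hasDerivAt x (hY x hx) using 1
    simp [M, K₁, K₂, K₃, K₄, p, w]
    ring

/-- Variation of parameters produces solutions of the perturbed Euler equation. -/
theorem hasDerivAt_variation_of_parameters {lam x : ℝ} (hx : 0 < x) {r : ℂ}
    {a b : ℝ → ℂ} {c : ℂ} (hc : c * (2 * Complex.I * lam) = 1)
    (ha : HasDerivAt a (-(c * (x : ℂ) ^ (1 / 2 + Complex.I * lam) * r) *
        (a x * (x : ℂ) ^ (1 / 2 - Complex.I * lam) +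
          b x * (c * (x : ℂ) ^ (1 / 2 + Complex.I * lam)))) x)
    (hb : HasDerivAt b ((x : ℂ) ^ (1 / 2 - Complex.I * lam) * r *
        (a x * (x : ℂ) ^ (1 / 2 - Complex.I * lam) +
          b x * (c * (x : ℂ) ^ (1 / 2 + Complex.I * lam)))) x) :
    HasDerivAt (fun y : ℝ => a y * (y : ℂ) ^ (1 / 2 - Complex.I * lam) +
          b y * (c * (y : ℂ) ^ (1 / 2 + Complex.I * lam)))
      ((a x * ((1 / 2 - Complex.I * lam) * (x : ℂ) ^ (1 / 2 - Complex.I * lam)) +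
        b x * (c * ((1 / 2 + Complex.I * lam) * (x : ℂ) ^ (1 / 2 + Complex.I * lam)))) / x) x ∧
    HasDerivAt (fun y : ℝ =>
      (a y * ((1 / 2 - Complex.I * lam) * (y : ℂ) ^ (1 / 2 - Complex.I * lam)) +
        b y * (c * ((1 / 2 + Complex.I * lam) * (y : ℂ) ^ (1 / 2 + Complex.I * lam)))) / y)
      (((-(lam : ℂ) ^ 2 - 1 / 4) / (x : ℂ) ^ 2 + r) *
        (a x * (x : ℂ) ^ (1 / 2 - Complex.I * lam) +
          b x * (c * (x : ℂ) ^ (1 / 2 + Complex.I * lam)))) x := by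
  have hx' : (x : ℂ) ≠ 0 := by exact_mod_cast hx.ne'
  have hp := hasDerivAt_ofReal_cpow_const_div (1 / 2 - Complex.I * lam) hx
  have hw := hasDerivAt_ofReal_cpow_const_div (1 / 2 + Complex.I * lam) hx
  have hpw := cpow_half_sub_mul_cpow_half_add (Complex.I * lam) hx
  have hid := (hasDerivAt_id (x : ℂ)).comp_ofReal
  have hI := Complex.I_sq
  constructor
  · convert! (ha.mul hp).add (hb.mul (hw.const_mul c)) using 1
    field_simp
    ring
  · convert! ((ha.mul (hp.const_mul _)).add (hb.mul ((hw.const_mul _).const_mul c))).div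
      hid hx' using 1
    simp only [id, Pi.add_apply, Pi.mul_apply]
    generalize (x : ℂ) ^ (1 / 2 - Complex.I * lam) = p at *
    generalize (x : ℂ) ^ (1 / 2 + Complex.I * lam) = w at *
    field_simp
    linear_combination (-16) * (x * c * r * (a x * p + b x * c * w) * (2 * Complex.I * lam)) * hpw
      - 16 * (x ^ 2 * r * (a x * p + b x * c * w)) * hc
      - 16 * (lam ^ 2 * (a x * p + b x * c * w)) * hI

theorem classical_solution_of_hasDerivAt {A : ℝ} {Q S T : ℝ → ℂ}
    (hQ : ContinuousOn Q (Ioo 0 A)) (hS : ∀ x ∈ Ioo 0 A, HasDerivAt S (T x) x)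
    (hT : ∀ x ∈ Ioo 0 A, HasDerivAt T (Q x * S x) x) {x : ℝ} (hx : x ∈ Ioo 0 A) :
    DifferentiableAt ℝ S x ∧ DifferentiableAt ℝ (deriv S) x ∧
      ContinuousAt (deriv (deriv S)) x ∧ deriv (deriv S) x = Q x * S x := by
  have hd : ∀ y ∈ Ioo 0 A, HasDerivAt (deriv S) (Q y * S y) y := fun y hy =>
    (hT y hy).congr_of_eventuallyEq <| by
      filter_upwards [isOpen_Ioo.mem_nhds hy] with z hz using (hS z hz).deriv
  refine ⟨(hS x hx).differentiableAt, (hd x hx).differentiableAt, ?_, (hd x hx).deriv⟩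
  refine ((hQ.continuousAt (isOpen_Ioo.mem_nhds hx)).mul (hS x hx).continuousAt).congr ?_
  filter_upwards [isOpen_Ioo.mem_nhds hx] with z hz using (hd z hz).deriv.symm

theorem tendsto_mul_cpow_of_tendsto_zero {b : ℝ → ℂ} (hb : Tendsto b (𝓝[>] 0) (𝓝 0)) (s : ℂ)
    (hs : s.re = 0) : Tendsto (fun x : ℝ => b x * (x : ℂ) ^ s) (𝓝[>] 0) (𝓝 0) := by
  refine squeeze_zero_norm' ?_ (tendsto_zero_iff_norm_tendsto_zero.1 hb)
  filter_upwards [self_mem_nhdsWithin] with x hx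
  rw [norm_mul, Complex.norm_cpow_eq_rpow_re_of_pos hx, hs]
  simp

theorem eq_of_hasDerivAt_zero_of_tendsto {A : ℝ} (hA : 0 < A) {f : ℝ → ℂ} {l : ℂ}
    (hf : ∀ x ∈ Ioo 0 A, HasDerivAt f 0 x) (hl : Tendsto f (𝓝[>] 0) (𝓝 l)) {x : ℝ}
    (hx : x ∈ Ioo 0 A) : f x = l := by
  refine tendsto_nhds_unique (tendsto_const_nhds.congr' ?_) hl
  filter_upwards [Ioo_mem_nhdsGT hA] with y hy
  exact isOpen_Ioo.is_const_of_deriv_eq_zero isPreconnected_Ioo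
    (fun z hz => (hf z hz).differentiableAt.differentiableWithinAt)
    (fun z hz => (hf z hz).deriv) hx hy

end Euler

/-- Existence of the fundamental system of solutions `{S₁₀, S₂₀}` of
`−u'' + q u = −μ² u` at the singular endpoint `x = 0`, with prescribed asymptotics
`x^{1/2−iλ}` and `(1/(2iλ))x^{1/2+iλ}` and unit Wronskian. -/
theorem stmt8 (lam A : ℝ) (hlam : lam ≠ 0) (hA : 0 < A)
    (q q₀ : ℝ → ℂ) (hqcont : ContinuousOn q (Set.Ioo 0 A))
    (hq : ∀ x ∈ Set.Ioo (0 : ℝ) A,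
      q x = (-(lam : ℂ) ^ 2 - 1/4) / (x : ℂ) ^ 2 + q₀ x)
    (hq₀ : IntegrableOn (fun t : ℝ => t * ‖q₀ t‖) (Set.Ioo 0 (A/2))) :
    ∀ μ : ℂ, ∃ S₁ S₂ : ℝ → ℂ,
      (∀ x ∈ Set.Ioo (0 : ℝ) A,
        DifferentiableAt ℝ S₁ x ∧ DifferentiableAt ℝ (deriv S₁) x ∧
        ContinuousAt (deriv (deriv S₁)) x ∧
        -(deriv (deriv S₁) x) + q x * S₁ x = -μ ^ 2 * S₁ x) ∧
      (∀ x ∈ Set.Ioo (0 : ℝ) A,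
        DifferentiableAt ℝ S₂ x ∧ DifferentiableAt ℝ (deriv S₂) x ∧
        ContinuousAt (deriv (deriv S₂)) x ∧
        -(deriv (deriv S₂) x) + q x * S₂ x = -μ ^ 2 * S₂ x) ∧
      Tendsto (fun x : ℝ => S₁ x * (x : ℂ) ^ ((-1/2 : ℂ) + Complex.I * lam))
        (nhdsWithin 0 (Set.Ioi 0)) (nhds 1) ∧
      Tendsto (fun x : ℝ =>
          2 * Complex.I * lam * S₂ x * (x : ℂ) ^ ((-1/2 : ℂ) - Complex.I * lam))
        (nhdsWithin 0 (Set.Ioi 0)) (nhds 1) ∧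
      (∀ x ∈ Set.Ioo (0 : ℝ) A, S₁ x * deriv S₂ x - deriv S₁ x * S₂ x = 1) := by
  intro μ
  have hl : (lam : ℂ) ≠ 0 := by exact_mod_cast hlam
  obtain ⟨c, hc⟩ : ∃ c : ℂ, c * (2 * Complex.I * lam) = 1 :=
    ⟨_, inv_mul_cancel₀ (mul_ne_zero (mul_ne_zero two_ne_zero Complex.I_ne_zero) hl)⟩
  set r : ℝ → ℂ := fun x => q x - (-(lam : ℂ) ^ 2 - 1 / 4) / (x : ℂ) ^ 2 + μ ^ 2 with hr
  have hrq : ∀ x ∈ Ioo 0 A, r x = q₀ x + μ ^ 2 := fun x hx => by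
    simp only [hr, hq x hx]
    ring
  have hrc : ContinuousOn r (Ioo 0 A) := by
    refine (hqcont.sub (continuousOn_const.div (by fun_prop) fun x hx => ?_)).add
      continuousOn_const
    exact pow_ne_zero 2 (by exact_mod_cast hx.1.ne')
  have hint : ∀ x ∈ Ioo 0 A, IntervalIntegrable (fun t => t * ‖r t‖) volume 0 x := by
    have hfc : ContinuousOn (fun t => t * ‖r t‖) (Ioo 0 A) := continuousOn_id.mul hrc.norm
    have hA2 : Ioo 0 (A / 2) ⊆ Ioo 0 A := Ioo_subset_Ioo_right (by linarith)
    refine fun x hx => intervalIntegrable_of_continuousOn_Ioo (half_pos hA) hfc ?_ hx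
    have hlin : IntegrableOn (fun t : ℝ => t * ‖μ ^ 2‖) (Ioo 0 (A / 2)) :=
      ((continuous_id.mul continuous_const).integrableOn_Icc).mono_set Ioo_subset_Icc_self
    refine (hq₀.add hlin).mono' ((hfc.mono hA2).aestronglyMeasurable measurableSet_Ioo) ?_
    refine (ae_restrict_iff' measurableSet_Ioo).2 (ae_of_all _ fun t ht => ?_)
    have ht0 : 0 ≤ t := ht.1.le
    rw [hrq t (hA2 ht), norm_mul, norm_norm, Real.norm_of_nonneg ht0, Pi.add_apply, ← mul_add]
    gcongr
    exact norm_add_le _ _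
  have hQ : ContinuousOn (fun x => q x + μ ^ 2) (Ioo 0 A) := hqcont.add continuousOn_const
  have hQr : ∀ x : ℝ, (-(lam : ℂ) ^ 2 - 1 / 4) / (x : ℂ) ^ 2 + r x = q x + μ ^ 2 := fun x => by
    simp only [hr]
    ring
  obtain ⟨a₁, b₁, ha₁, hb₁, ha₁0, hb₁0⟩ :=
    exists_variation_of_parameters (lam := lam) hA hrc hint c 1 0
  obtain ⟨a₂, b₂, ha₂, hb₂, ha₂0, hb₂0⟩ :=
    exists_variation_of_parameters (lam := lam) hA hrc hint c 0 1
  have h₁ := fun x (hx : x ∈ Ioo 0 A) =>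
    hasDerivAt_variation_of_parameters hx.1 hc (ha₁ x hx) (hb₁ x hx)
  have h₂ := fun x (hx : x ∈ Ioo 0 A) =>
    hasDerivAt_variation_of_parameters hx.1 hc (ha₂ x hx) (hb₂ x hx)
  simp only [hQr] at h₁ h₂
  refine ⟨fun y : ℝ => a₁ y * (y : ℂ) ^ (1 / 2 - Complex.I * lam) +
      b₁ y * (c * (y : ℂ) ^ (1 / 2 + Complex.I * lam)),
    fun y : ℝ => a₂ y * (y : ℂ) ^ (1 / 2 - Complex.I * lam) +
      b₂ y * (c * (y : ℂ) ^ (1 / 2 + Complex.I * lam)),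
    fun x hx => ?_, fun x hx => ?_, ?_, ?_, fun x hx => ?_⟩
  · obtain ⟨hd, hd', hcont, he⟩ := classical_solution_of_hasDerivAt hQ
      (fun x hx => (h₁ x hx).1) (fun x hx => (h₁ x hx).2) hx
    exact ⟨hd, hd', hcont, by rw [he]; ring⟩
  · obtain ⟨hd, hd', hcont, he⟩ := classical_solution_of_hasDerivAt hQ
      (fun x hx => (h₂ x hx).1) (fun x hx => (h₂ x hx).2) hx
    exact ⟨hd, hd', hcont, by rw [he]; ring⟩
  · have h := ha₁0.add ((tendsto_mul_cpow_of_tendsto_zero hb₁0 (2 * (Complex.I * lam))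
      (by simp)).const_mul c)
    rw [mul_zero, add_zero] at h
    refine h.congr' ?_
    filter_upwards [self_mem_nhdsWithin] with x hx
    have hx' : (x : ℂ) ≠ 0 := by exact_mod_cast (ne_of_gt hx)
    have e₁ : (x : ℂ) ^ (1 / 2 - Complex.I * lam) * (x : ℂ) ^ (-1 / 2 + Complex.I * lam) = 1 := by
      rw [← Complex.cpow_add _ _ hx', ← Complex.cpow_zero (x : ℂ)]
      ring_nf
    have e₂ : (x : ℂ) ^ (1 / 2 + Complex.I * lam) * (x : ℂ) ^ (-1 / 2 + Complex.I * lam) =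
        (x : ℂ) ^ (2 * (Complex.I * lam)) := by
      rw [← Complex.cpow_add _ _ hx']
      ring_nf
    linear_combination (-a₁ x) * e₁ - c * b₁ x * e₂
  · have h := hb₂0.add ((tendsto_mul_cpow_of_tendsto_zero ha₂0 (-(2 * (Complex.I * lam)))
      (by simp)).const_mul (2 * Complex.I * lam))
    rw [mul_zero, add_zero] at h
    refine h.congr' ?_
    filter_upwards [self_mem_nhdsWithin] with x hx
    have hx' : (x : ℂ) ≠ 0 := by exact_mod_cast (ne_of_gt hx)
    have e₁ : (x : ℂ) ^ (1 / 2 + Complex.I * lam) * (x : ℂ) ^ (-1 / 2 - Complex.I * lam) = 1 := by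
      rw [← Complex.cpow_add _ _ hx', ← Complex.cpow_zero (x : ℂ)]
      ring_nf
    have e₂ : (x : ℂ) ^ (1 / 2 - Complex.I * lam) * (x : ℂ) ^ (-1 / 2 - Complex.I * lam) =
        (x : ℂ) ^ (-(2 * (Complex.I * lam))) := by
      rw [← Complex.cpow_add _ _ hx']
      ring_nf
    linear_combination (-b₂ x) * e₁ - (2 * Complex.I * lam) * a₂ x * e₂ -
      b₂ x * (x : ℂ) ^ (1 / 2 + Complex.I * lam) * (x : ℂ) ^ (-1 / 2 - Complex.I * lam) * hc
  · have hx' : (x : ℂ) ≠ 0 := by exact_mod_cast hx.1.ne'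
    have hdet : a₁ x * b₂ x - a₂ x * b₁ x = 1 := by
      refine eq_of_hasDerivAt_zero_of_tendsto hA
        (f := fun y => a₁ y * b₂ y - a₂ y * b₁ y) (fun y hy => ?_)
        (by simpa using (ha₁0.mul hb₂0).sub (ha₂0.mul hb₁0)) hx
      convert! ((ha₁ y hy).mul (hb₂ y hy)).sub ((ha₂ y hy).mul (hb₁ y hy)) using 1
      ring
    rw [(h₁ x hx).1.deriv, (h₂ x hx).1.deriv]
    have hpw := cpow_half_sub_mul_cpow_half_add (Complex.I * lam) hx.1
    beta_reduce
    generalize (x : ℂ) ^ (1 / 2 - Complex.I * lam) = p at *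
    generalize (x : ℂ) ^ (1 / 2 + Complex.I * lam) = w at *
    linear_combination (x : ℂ)⁻¹ * (p * w * (c * (2 * Complex.I * lam)) * hdet + p * w * hc + hpw)
      + mul_inv_cancel₀ hx'
end

section
/- Let λ ∈ ℝ \ {0} and A > 0, and let q : (0,A) → ℂ be continuous with q(x) = (−λ²−1/4)/x² + q₀(x), where ∫₀^{A/2} t·|q₀(t)| dt < ∞. Fix μ ∈ ℂ. If u, v : (0,A) → ℂ are twice continuously differentiable, both satisfy −w''(x) + q(x)·w(x) = −μ²·w(x) on (0,A), and both satisfy u(x)·x^{−1/2+iλ} → 1 and v(x)·x^{−1/2+iλ} → 1 as x → 0⁺ (principal-branch complex powers), then u = v on (0,A). -/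
open Filter MeasureTheory

/-- A function on `(0, b)` whose derivative is dominated by an integrable function has a limit at
the left endpoint, and its distance to that limit is controlled by the dominating integral. -/
theorem exists_tendsto_of_norm_deriv_le {b : ℝ} (hb : 0 < b) {W g : ℝ → ℂ} {k : ℝ → ℝ}
    (hW : ∀ x ∈ Set.Ioo 0 b, HasDerivAt W (g x) x) (hg : ContinuousOn g (Set.Ioo 0 b))
    (hk : IntegrableOn k (Set.Ioo 0 b)) (hgk : ∀ x ∈ Set.Ioo 0 b, ‖g x‖ ≤ k x) :
    ∃ L, Tendsto W (nhdsWithin 0 (Set.Ioi 0)) (nhds L) ∧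
      ∀ x ∈ Set.Ioo 0 b, ‖W x - L‖ ≤ ∫ t in (0 : ℝ)..x, k t := by
  have hgi : IntegrableOn g (Set.Ioo 0 b) :=
    Integrable.mono' hk (hg.aestronglyMeasurable measurableSet_Ioo)
      ((ae_restrict_iff' measurableSet_Ioo).2 (Eventually.of_forall hgk))
  have hgI : IntervalIntegrable g volume 0 b :=
    (intervalIntegrable_iff_integrableOn_Ioo_of_le hb.le).2 hgi
  have hkI : IntervalIntegrable k volume 0 b :=
    (intervalIntegrable_iff_integrableOn_Ioo_of_le hb.le).2 hk
  have hsub : ∀ x ∈ Set.Ioo 0 b, Set.uIcc 0 x ⊆ Set.uIcc 0 b := fun x hx =>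
    Set.uIcc_subset_uIcc_left (by rw [Set.uIcc_of_le hb.le]; exact ⟨hx.1.le, hx.2.le⟩)
  have hG : ∀ x ∈ Set.Ioo 0 b, HasDerivAt (fun y => ∫ t in (0 : ℝ)..y, g t) (g x) x := by
    intro x hx
    exact intervalIntegral.integral_hasDerivAt_right (hgI.mono_set (hsub x hx))
      (hg.stronglyMeasurableAtFilter isOpen_Ioo x hx) (hg.continuousAt (isOpen_Ioo.mem_nhds hx))
  have hD : ∀ x ∈ Set.Ioo 0 b, HasDerivAt (fun y => W y - ∫ t in (0 : ℝ)..y, g t) 0 x := by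
    intro x hx
    have h := (hW x hx).sub (hG x hx)
    rw [sub_self] at h
    exact h
  obtain ⟨L, hL⟩ := isOpen_Ioo.exists_is_const_of_deriv_eq_zero isPreconnected_Ioo
    (fun x hx => (hD x hx).differentiableAt.differentiableWithinAt) (fun x hx => (hD x hx).deriv)
  refine ⟨L, ?_, ?_⟩
  · have hc : ContinuousWithinAt (fun y => ∫ t in (0 : ℝ)..y, g t) (Set.Icc 0 b) 0 :=
      intervalIntegral.continuousWithinAt_primitive (by simp) (by simpa [hb.le] using hgI)
    have hc' : Tendsto (fun y => ∫ t in (0 : ℝ)..y, g t) (nhdsWithin 0 (Set.Ioi 0)) (nhds 0) := by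
      have h := hc.mono Set.Ioo_subset_Icc_self
      rw [ContinuousWithinAt, nhdsWithin_Ioo_eq_nhdsGT hb] at h
      simpa using h
    have h := hc'.const_add L
    rw [add_zero] at h
    refine h.congr' ?_
    filter_upwards [Ioo_mem_nhdsGT hb] with x hx
    rw [← hL x hx]; ring
  · intro x hx
    have : W x - L = ∫ t in (0 : ℝ)..x, g t := by rw [← hL x hx]; ring
    rw [this]
    refine (intervalIntegral.norm_integral_le_integral_norm hx.1.le).trans ?_
    exact intervalIntegral.integral_mono_on_of_le_Ioo hx.1.le (hgI.mono_set (hsub x hx)).norm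
      (hkI.mono_set (hsub x hx)) (fun t ht => hgk t ⟨ht.1, ht.2.trans hx.2⟩)

/-- If `W₁ - x ^ (2 i λ) W₂` tends to zero at `0⁺` while `W₁` and `W₂` converge, then both limits
vanish, because `x ^ (2 i λ)` oscillates. -/
theorem limits_eq_zero_of_oscillation {lam : ℝ} (hlam : lam ≠ 0) {W₁ W₂ : ℝ → ℂ} {L₁ L₂ : ℂ}
    (h₁ : Tendsto W₁ (nhdsWithin 0 (Set.Ioi 0)) (nhds L₁))
    (h₂ : Tendsto W₂ (nhdsWithin 0 (Set.Ioi 0)) (nhds L₂))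
    (h : Tendsto (fun x : ℝ => W₁ x - (x : ℂ) ^ (2 * Complex.I * lam) * W₂ x)
      (nhdsWithin 0 (Set.Ioi 0)) (nhds 0)) : L₁ = 0 ∧ L₂ = 0 := by
  have key : ∀ (a : ℝ) (e : ℂ), (∀ n : ℕ, Complex.exp
      (((-((n + a) * (Real.pi / |lam|)) : ℝ) : ℂ) * (2 * Complex.I * lam)) = e) →
      L₁ - e * L₂ = 0 := by
    intro a e he
    have hpos : 0 < Real.pi / |lam| := div_pos Real.pi_pos (abs_pos.2 hlam)
    have hs : Tendsto (fun n : ℕ => Real.exp (-((n + a) * (Real.pi / |lam|)))) atTop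
        (nhdsWithin 0 (Set.Ioi 0)) := by
      refine tendsto_nhdsWithin_iff.2 ⟨?_, Eventually.of_forall fun n => Real.exp_pos _⟩
      refine Real.tendsto_exp_neg_atTop_nhds_zero.comp ?_
      exact (tendsto_atTop_add_const_right _ a tendsto_natCast_atTop_atTop).atTop_mul_const hpos
    refine tendsto_nhds_unique ((h₁.comp hs).sub ((h₂.comp hs).const_mul e)) ?_
    refine (h.comp hs).congr fun n => ?_
    simp only [Function.comp_apply]
    rw [← he n, Complex.cpow_def_of_ne_zero (by exact_mod_cast (Real.exp_pos _).ne'),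
      ← Complex.ofReal_log (Real.exp_pos _).le, Real.log_exp]
  have habs : ∃ s : ℤ, (s = 1 ∨ s = -1) ∧ (lam : ℝ) = s * |lam| := by
    rcases abs_cases lam with ⟨h, -⟩ | ⟨h, -⟩
    · exact ⟨1, Or.inl rfl, by rw [h]; simp⟩
    · exact ⟨-1, Or.inr rfl, by rw [h]; simp⟩
  obtain ⟨s, hs, hls⟩ := habs
  have hne : ((|lam| : ℝ) : ℂ) ≠ 0 := by exact_mod_cast abs_ne_zero.2 hlam
  have hexp : ∀ (a : ℝ) (n : ℕ),
      (((-((n + a) * (Real.pi / |lam|)) : ℝ) : ℂ) * (2 * Complex.I * lam)) =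
        ((-s * n : ℤ) : ℂ) * (2 * Real.pi * Complex.I) - s * (2 * a) * (Real.pi * Complex.I) := by
    intro a n
    have hls' : (lam : ℂ) = s * ((|lam| : ℝ) : ℂ) := by exact_mod_cast hls
    rw [hls']
    push_cast
    field_simp
    ring
  have e₀ := key 0 1 fun n => by
    rw [hexp, Complex.exp_sub, Complex.exp_int_mul_two_pi_mul_I]
    simp
  have e₁ := key (1 / 2) (-1) fun n => by
    rw [hexp, Complex.exp_sub, Complex.exp_int_mul_two_pi_mul_I]
    rcases hs with rfl | rfl <;> simp [Complex.exp_neg]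
  constructor
  · linear_combination (e₀ + e₁) / 2
  · linear_combination (e₁ - e₀) / 2

/-- Derivative of the Wronskian-type expression of `w` with the model solution `x ^ c`. -/
theorem hasDerivAt_wronskian_cpow {w : ℝ → ℂ} {c P : ℂ} {x : ℝ} (hx : 0 < x)
    (hw : DifferentiableAt ℝ w x) (hw' : DifferentiableAt ℝ (deriv w) x)
    (hode : deriv (deriv w) x = ((c ^ 2 - c) / (x : ℂ) ^ 2 + P) * w x) :
    HasDerivAt (fun t : ℝ => (t : ℂ) ^ c * (c / t * w t - deriv w t))
      (-((x : ℂ) ^ c * P * w x)) x := by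
  have hx0 : (x : ℂ) ≠ 0 := by exact_mod_cast hx.ne'
  have h1 : HasDerivAt (fun t : ℝ => (t : ℂ) ^ c) (c * (x : ℂ) ^ (c - 1) * 1) x :=
    ((hasDerivAt_id (x : ℂ)).cpow_const (Complex.ofReal_mem_slitPlane.2 hx)).comp_ofReal
  have h2 : HasDerivAt (fun t : ℝ => c / (t : ℂ)) (c * (-((x : ℂ) ^ 2)⁻¹)) x := by
    simpa [div_eq_mul_inv] using ((hasDerivAt_inv hx0).const_mul c).comp_ofReal
  have h := h1.mul ((h2.mul hw.hasDerivAt).sub hw'.hasDerivAt)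
  refine h.congr_deriv ?_
  simp only [Pi.mul_apply, Pi.sub_apply]
  rw [hode, Complex.cpow_sub _ _ hx0, Complex.cpow_one]
  field_simp
  ring

/-- A solution of `w'' = ((-λ² - 1/4) / x² + Q) w` that is `O(x ^ (1/2))` on `(0, b)` and
`o(x ^ (1/2))` at the origin satisfies an integral improvement of its own bound. -/
theorem norm_le_of_isLittleO {lam b M : ℝ} (hlam : lam ≠ 0) (hb : 0 < b) {w Q : ℝ → ℂ}
    (hQ : ContinuousOn Q (Set.Ioo 0 b))
    (hQi : IntegrableOn (fun t : ℝ => t * ‖Q t‖) (Set.Ioo 0 b))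
    (hw : ∀ x ∈ Set.Ioo 0 b, DifferentiableAt ℝ w x ∧ DifferentiableAt ℝ (deriv w) x ∧
      deriv (deriv w) x = ((-(lam : ℂ) ^ 2 - 1 / 4) / (x : ℂ) ^ 2 + Q x) * w x)
    (hlim : Tendsto (fun x : ℝ => w x * (x : ℂ) ^ ((-1 / 2 : ℂ) + Complex.I * lam))
      (nhdsWithin 0 (Set.Ioi 0)) (nhds 0))
    (hM : ∀ x ∈ Set.Ioo 0 b, ‖w x‖ ≤ M * x ^ (1 / 2 : ℝ)) :
    ∀ x ∈ Set.Ioo 0 b,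
      ‖w x‖ ≤ M / |lam| * (∫ t in (0 : ℝ)..x, t * ‖Q t‖) * x ^ (1 / 2 : ℝ) := by
  have hsq : ∀ x : ℝ, 0 < x → x ^ (1 / 2 : ℝ) * x ^ (1 / 2 : ℝ) = x := fun x hx => by
    rw [← Real.rpow_add hx]; norm_num
  have hnorm : ∀ (σ x : ℝ), 0 < x → ‖(x : ℂ) ^ ((1 / 2 : ℂ) + Complex.I * σ)‖ =
      x ^ (1 / 2 : ℝ) := by
    intro σ x hx
    rw [Complex.norm_cpow_eq_rpow_re_of_pos hx]
    simp
  have key : ∀ σ : ℝ, σ ^ 2 = lam ^ 2 → ∃ L, Tendsto (fun t : ℝ =>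
        (t : ℂ) ^ ((1 / 2 : ℂ) + Complex.I * σ) *
          (((1 / 2 : ℂ) + Complex.I * σ) / t * w t - deriv w t))
        (nhdsWithin 0 (Set.Ioi 0)) (nhds L) ∧
      ∀ x ∈ Set.Ioo 0 b, ‖(x : ℂ) ^ ((1 / 2 : ℂ) + Complex.I * σ) *
          (((1 / 2 : ℂ) + Complex.I * σ) / x * w x - deriv w x) - L‖ ≤
        ∫ t in (0 : ℝ)..x, M * (t * ‖Q t‖) := by
    intro σ hσ
    have hσ' : (σ : ℂ) ^ 2 = (lam : ℂ) ^ 2 := by exact_mod_cast hσ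
    refine exists_tendsto_of_norm_deriv_le hb
      (g := fun x : ℝ => -((x : ℂ) ^ ((1 / 2 : ℂ) + Complex.I * σ) * Q x * w x))
      (fun x hx => ?_) ?_ (hQi.const_mul M) (fun x hx => ?_)
    · obtain ⟨h1, h2, h3⟩ := hw x hx
      refine hasDerivAt_wronskian_cpow hx.1 h1 h2 ?_
      rw [h3]
      congr 3
      linear_combination hσ' - σ ^ 2 * Complex.I_sq
    · refine ((ContinuousOn.mul ?_ hQ).mul
        fun x hx => (hw x hx).1.continuousAt.continuousWithinAt).neg
      exact Complex.continuous_ofReal.continuousOn.cpow_const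
        fun x hx => Complex.ofReal_mem_slitPlane.2 hx.1
    · rw [norm_neg, norm_mul, norm_mul, hnorm σ x hx.1]
      calc x ^ (1 / 2 : ℝ) * ‖Q x‖ * ‖w x‖
          ≤ x ^ (1 / 2 : ℝ) * ‖Q x‖ * (M * x ^ (1 / 2 : ℝ)) := by
            have := Real.rpow_nonneg hx.1.le (1 / 2)
            gcongr
            exact hM x hx
        _ = M * ((x ^ (1 / 2 : ℝ) * x ^ (1 / 2 : ℝ)) * ‖Q x‖) := by ring
        _ = M * (x * ‖Q x‖) := by rw [hsq x hx.1]
  obtain ⟨L₁, hL₁, hb₁⟩ := key lam rfl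
  obtain ⟨L₂, hL₂, hb₂⟩ := key (-lam) (by ring)
  have hprod : ∀ x : ℝ, 0 < x → (x : ℂ) ^ ((1 / 2 : ℂ) + Complex.I * lam) *
      (x : ℂ) ^ ((1 / 2 : ℂ) + Complex.I * (-lam : ℝ)) = x := by
    intro x hx
    have hx0 : (x : ℂ) ≠ 0 := by exact_mod_cast hx.ne'
    rw [← Complex.cpow_add _ _ hx0]
    convert Complex.cpow_one (x : ℂ) using 2
    push_cast; ring
  have hrep : ∀ x : ℝ, 0 < x → 2 * Complex.I * lam * w x =
      (x : ℂ) ^ ((1 / 2 : ℂ) + Complex.I * (-lam : ℝ)) *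
        ((x : ℂ) ^ ((1 / 2 : ℂ) + Complex.I * lam) *
          (((1 / 2 : ℂ) + Complex.I * lam) / x * w x - deriv w x)) -
      (x : ℂ) ^ ((1 / 2 : ℂ) + Complex.I * lam) *
        ((x : ℂ) ^ ((1 / 2 : ℂ) + Complex.I * (-lam : ℝ)) *
          (((1 / 2 : ℂ) + Complex.I * (-lam : ℝ)) / x * w x - deriv w x)) := by
    intro x hx
    have hx0 : (x : ℂ) ≠ 0 := by exact_mod_cast hx.ne'
    have hd : (x : ℂ) * (((1 / 2 : ℂ) + Complex.I * lam) / x * w x - deriv w x) -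
        x * (((1 / 2 : ℂ) + Complex.I * (-lam : ℝ)) / x * w x - deriv w x) =
        2 * Complex.I * lam * w x := by
      push_cast
      field_simp
      ring
    have hp := hprod x hx
    generalize ((1 / 2 : ℂ) + Complex.I * lam) / x * w x - deriv w x = α at hd ⊢
    generalize ((1 / 2 : ℂ) + Complex.I * (-lam : ℝ)) / x * w x - deriv w x = β at hd ⊢
    linear_combination (-1) * hd - (α - β) * hp
  obtain ⟨rfl, rfl⟩ := limits_eq_zero_of_oscillation hlam hL₁ hL₂ (by
    have h := hlim.const_mul (2 * Complex.I * lam)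
    rw [mul_zero] at h
    refine h.congr' ?_
    filter_upwards [self_mem_nhdsWithin] with x hx
    have hx0 : (x : ℂ) ≠ 0 := by exact_mod_cast (Set.mem_Ioi.1 hx).ne'
    rw [← mul_assoc, hrep x hx]
    have e1 : (x : ℂ) ^ ((1 / 2 : ℂ) + Complex.I * (-lam : ℝ)) *
        (x : ℂ) ^ ((-1 / 2 : ℂ) + Complex.I * lam) = 1 := by
      rw [← Complex.cpow_add _ _ hx0]
      convert Complex.cpow_zero (x : ℂ) using 2
      push_cast; ring
    have e2 : (x : ℂ) ^ ((1 / 2 : ℂ) + Complex.I * lam) *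
        (x : ℂ) ^ ((-1 / 2 : ℂ) + Complex.I * lam) = (x : ℂ) ^ (2 * Complex.I * lam) := by
      rw [← Complex.cpow_add _ _ hx0]
      congr 1
      ring
    rw [sub_mul, mul_right_comm, e1, one_mul, mul_right_comm, e2])
  intro x hx
  have h1 := hb₁ x hx
  have h2 := hb₂ x hx
  rw [sub_zero, intervalIntegral.integral_const_mul] at h1 h2
  have h3 : ‖2 * Complex.I * lam * w x‖ ≤
      x ^ (1 / 2 : ℝ) * (M * ∫ t in (0 : ℝ)..x, t * ‖Q t‖) +
      x ^ (1 / 2 : ℝ) * (M * ∫ t in (0 : ℝ)..x, t * ‖Q t‖) := by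
    rw [hrep x hx.1]
    refine (norm_sub_le _ _).trans (add_le_add ?_ ?_)
    · rw [norm_mul, hnorm _ x hx.1]
      exact mul_le_mul_of_nonneg_left h1 (Real.rpow_nonneg hx.1.le _)
    · rw [norm_mul, hnorm _ x hx.1]
      exact mul_le_mul_of_nonneg_left h2 (Real.rpow_nonneg hx.1.le _)
  have h4 : ‖2 * Complex.I * lam * w x‖ = 2 * |lam| * ‖w x‖ := by simp
  rw [h4] at h3
  have hl : 0 < |lam| := abs_pos.2 hlam
  rw [div_mul_eq_mul_div, div_mul_eq_mul_div, le_div_iff₀ hl]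
  linarith

/-- A solution of a second-order linear equation `w'' = p w` with continuous `p` that vanishes near
one end of an interval vanishes throughout. -/
theorem eq_zero_of_eq_zero_near_left {δ A : ℝ} (hδ : 0 < δ) {w p : ℝ → ℂ}
    (hp : ContinuousOn p (Set.Ioo 0 A))
    (hw : ∀ x ∈ Set.Ioo 0 A, DifferentiableAt ℝ w x ∧ DifferentiableAt ℝ (deriv w) x ∧
      deriv (deriv w) x = p x * w x)
    (h0 : ∀ x ∈ Set.Ioo 0 δ, w x = 0) : ∀ x ∈ Set.Ioo 0 A, w x = 0 := by
  intro x hx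
  by_cases hxδ : x < δ
  · exact h0 x ⟨hx.1, hxδ⟩
  push Not at hxδ
  have hmem : δ / 2 ∈ Set.Ioo 0 δ := ⟨by linarith, by linarith⟩
  have hsub : Set.Icc (δ / 2) x ⊆ Set.Ioo 0 A := fun t ht =>
    ⟨hmem.1.trans_le ht.1, ht.2.trans_lt hx.2⟩
  obtain ⟨K, hK⟩ := isCompact_Icc.exists_bound_of_continuousOn (hp.mono hsub)
  have hd : deriv w (δ / 2) = 0 := by
    have : w =ᶠ[nhds (δ / 2)] fun _ => 0 := by
      filter_upwards [isOpen_Ioo.mem_nhds hmem] with t ht using h0 t ht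
    rw [this.deriv_eq]; simp
  have h := norm_le_gronwallBound_of_norm_deriv_right_le (f := fun t => (w t, deriv w t))
    (f' := fun t => (deriv w t, deriv (deriv w) t)) (δ := 0) (K := max 1 K) (ε := 0)
    (a := δ / 2) (b := x)
    (fun t ht => ((hw t (hsub ht)).1.continuousAt.prodMk
      (hw t (hsub ht)).2.1.continuousAt).continuousWithinAt)
    (fun t ht => ((hw t (hsub (Set.Ico_subset_Icc_self ht))).1.hasDerivAt.prodMk
      (hw t (hsub (Set.Ico_subset_Icc_self ht))).2.1.hasDerivAt).hasDerivWithinAt)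
    (by simp [hd, h0 _ hmem])
    (fun t ht => by
      have ht' := Set.Ico_subset_Icc_self ht
      rw [add_zero, (hw t (hsub ht')).2.2, Prod.norm_mk, Prod.norm_mk, norm_mul]
      refine max_le ?_ ?_
      · calc ‖deriv w t‖ = 1 * ‖deriv w t‖ := (one_mul _).symm
          _ ≤ _ := mul_le_mul (le_max_left _ _) (le_max_right _ _) (norm_nonneg _) (by positivity)
      · exact mul_le_mul ((hK t ht').trans (le_max_right _ _)) (le_max_left _ _)
          (norm_nonneg _) (by positivity))
    x ⟨by linarith, le_rfl⟩
  rw [gronwallBound_ε0_δ0] at h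
  have := norm_le_zero_iff.1 h
  exact congrArg Prod.fst this

/-- Uniqueness of the Jost-type solution of `−w'' + q w = −μ² w` with prescribed
asymptotic behavior `x^{1/2−iλ}` at the regular singular endpoint `x = 0`. -/
theorem stmt9 (lam A : ℝ) (hlam : lam ≠ 0) (hA : 0 < A)
    (q q₀ : ℝ → ℂ) (hqcont : ContinuousOn q (Set.Ioo 0 A))
    (hq : ∀ x ∈ Set.Ioo (0 : ℝ) A,
      q x = (-(lam : ℂ) ^ 2 - 1/4) / (x : ℂ) ^ 2 + q₀ x)
    (hq₀ : IntegrableOn (fun t : ℝ => t * ‖q₀ t‖) (Set.Ioo 0 (A/2)))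
    (μ : ℂ) (u v : ℝ → ℂ)
    (hu : ∀ x ∈ Set.Ioo (0 : ℝ) A,
      DifferentiableAt ℝ u x ∧ DifferentiableAt ℝ (deriv u) x ∧
      ContinuousAt (deriv (deriv u)) x ∧
      -(deriv (deriv u) x) + q x * u x = -μ ^ 2 * u x)
    (hv : ∀ x ∈ Set.Ioo (0 : ℝ) A,
      DifferentiableAt ℝ v x ∧ DifferentiableAt ℝ (deriv v) x ∧
      ContinuousAt (deriv (deriv v)) x ∧
      -(deriv (deriv v) x) + q x * v x = -μ ^ 2 * v x)
    (hlimu : Tendsto (fun x : ℝ => u x * (x : ℂ) ^ ((-1/2 : ℂ) + Complex.I * lam))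
      (nhdsWithin 0 (Set.Ioi 0)) (nhds 1))
    (hlimv : Tendsto (fun x : ℝ => v x * (x : ℂ) ^ ((-1/2 : ℂ) + Complex.I * lam))
      (nhdsWithin 0 (Set.Ioi 0)) (nhds 1)) :
    ∀ x ∈ Set.Ioo (0 : ℝ) A, u x = v x := by
  have hQ₀ : ContinuousOn q₀ (Set.Ioo 0 A) := by
    have h : ContinuousOn (fun x : ℝ => q x - (-(lam : ℂ) ^ 2 - 1/4) / (x : ℂ) ^ 2)
        (Set.Ioo 0 A) := by
      refine hqcont.sub (continuousOn_const.div (by fun_prop) fun x hx => ?_)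
      exact pow_ne_zero 2 (by exact_mod_cast hx.1.ne')
    exact h.congr fun x hx => by simp only [hq x hx]; ring
  have hQ : ContinuousOn (fun x => q₀ x + μ ^ 2) (Set.Ioo 0 A) := hQ₀.add continuousOn_const
  have hA2 : Set.Ioo 0 (A / 2) ⊆ Set.Ioo 0 A := Set.Ioo_subset_Ioo_right (by linarith)
  have hQi : IntegrableOn (fun t : ℝ => t * ‖q₀ t + μ ^ 2‖) (Set.Ioo 0 (A / 2)) := by
    have hlin : IntegrableOn (fun t : ℝ => t * ‖μ ^ 2‖) (Set.Ioo 0 (A / 2)) :=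
      ((by fun_prop : Continuous fun t : ℝ => t * ‖μ ^ 2‖).continuousOn.integrableOn_Icc).mono_set
        Set.Ioo_subset_Icc_self
    refine Integrable.mono' (hq₀.add hlin)
      ((continuousOn_id.mul (hQ.mono hA2).norm).aestronglyMeasurable measurableSet_Ioo)
      ((ae_restrict_iff' measurableSet_Ioo).2 (Eventually.of_forall fun t ht => ?_))
    rw [Real.norm_of_nonneg (mul_nonneg ht.1.le (norm_nonneg _))]
    simp only [Pi.add_apply]
    rw [← mul_add]
    exact mul_le_mul_of_nonneg_left (norm_add_le _ _) ht.1.le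
  set w : ℝ → ℂ := fun x => u x - v x
  have hdw : ∀ x ∈ Set.Ioo (0 : ℝ) A, deriv w x = deriv u x - deriv v x := fun x hx =>
    deriv_fun_sub (hu x hx).1 (hv x hx).1
  have hdw' : ∀ x ∈ Set.Ioo (0 : ℝ) A,
      deriv w =ᶠ[nhds x] fun y => deriv u y - deriv v y := fun x hx => by
    filter_upwards [isOpen_Ioo.mem_nhds hx] with y hy using hdw y hy
  have hw : ∀ x ∈ Set.Ioo (0 : ℝ) A, DifferentiableAt ℝ w x ∧ DifferentiableAt ℝ (deriv w) x ∧
      deriv (deriv w) x =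
        ((-(lam : ℂ) ^ 2 - 1 / 4) / (x : ℂ) ^ 2 + (q₀ x + μ ^ 2)) * w x := by
    intro x hx
    obtain ⟨hu1, hu2, -, hu3⟩ := hu x hx
    obtain ⟨hv1, hv2, -, hv3⟩ := hv x hx
    refine ⟨hu1.sub hv1, (hu2.sub hv2).congr_of_eventuallyEq (hdw' x hx), ?_⟩
    rw [(hdw' x hx).deriv_eq, deriv_fun_sub hu2 hv2]
    rw [hq x hx] at hu3 hv3
    linear_combination hv3 - hu3
  have hlim : Tendsto (fun x : ℝ => w x * (x : ℂ) ^ ((-1 / 2 : ℂ) + Complex.I * lam))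
      (nhdsWithin 0 (Set.Ioi 0)) (nhds 0) := by
    have h := hlimu.sub hlimv
    rw [sub_self] at h
    exact h.congr fun x => (sub_mul _ _ _).symm
  have hpos : 0 < |lam| := abs_pos.2 hlam
  have hprim : Tendsto (fun y => ∫ t in (0 : ℝ)..y, t * ‖q₀ t + μ ^ 2‖)
      (nhdsWithin 0 (Set.Ioi 0)) (nhds 0) := by
    have hA2' : (0 : ℝ) < A / 2 := by linarith
    have hc : ContinuousWithinAt (fun y => ∫ t in (0 : ℝ)..y, t * ‖q₀ t + μ ^ 2‖)
        (Set.Icc 0 (A / 2)) 0 :=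
      intervalIntegral.continuousWithinAt_primitive (by simp) (by
        rw [min_self, max_eq_right hA2'.le]
        exact (intervalIntegrable_iff_integrableOn_Ioo_of_le hA2'.le).2 hQi)
    have h := hc.mono Set.Ioo_subset_Icc_self
    rw [ContinuousWithinAt, nhdsWithin_Ioo_eq_nhdsGT hA2'] at h
    simpa using h
  have hev : ∀ᶠ x : ℝ in nhdsWithin 0 (Set.Ioi 0), x < A / 2 ∧
      ‖w x * (x : ℂ) ^ ((-1 / 2 : ℂ) + Complex.I * lam)‖ < 1 ∧
      (∫ t in (0 : ℝ)..x, t * ‖q₀ t + μ ^ 2‖) < |lam| / 2 := by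
    have hn := hlim.norm
    rw [norm_zero] at hn
    filter_upwards [Ioo_mem_nhdsGT (show (0 : ℝ) < A / 2 by linarith),
      hn.eventually_lt_const one_pos, hprim.eventually_lt_const (half_pos hpos)] with x h1 h2 h3
    exact ⟨h1.2, h2, h3⟩
  obtain ⟨δ, hδ, hδ'⟩ := mem_nhdsGT_iff_exists_Ioo_subset.1 hev
  have hδ0 : (0 : ℝ) < δ := hδ
  have hδA : Set.Ioo 0 δ ⊆ Set.Ioo 0 (A / 2) := fun x hx => ⟨hx.1, (hδ' hx).1⟩
  have hbound : ∀ n : ℕ, ∀ x ∈ Set.Ioo 0 δ, ‖w x‖ ≤ (1 / 2 : ℝ) ^ n * x ^ (1 / 2 : ℝ) := by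
    intro n
    induction n with
    | zero =>
      intro x hx
      have h := (hδ' hx).2.1.le
      rw [norm_mul, Complex.norm_cpow_eq_rpow_re_of_pos hx.1] at h
      have hre : ((-1 / 2 : ℂ) + Complex.I * lam).re = -(1 / 2 : ℝ) := by simp; norm_num
      rw [hre, Real.rpow_neg hx.1.le, ← div_eq_mul_inv,
        div_le_iff₀ (Real.rpow_pos_of_pos hx.1 _)] at h
      simpa using h
    | succ n ih =>
      intro x hx
      refine (norm_le_of_isLittleO hlam hδ0 (hQ.mono (hδA.trans hA2)) (hQi.mono_set hδA)
        (fun y hy => hw y (hA2 (hδA hy))) hlim ih x hx).trans ?_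
      refine mul_le_mul_of_nonneg_right ?_ (Real.rpow_nonneg hx.1.le _)
      rw [div_mul_eq_mul_div, div_le_iff₀ hpos, pow_succ (1 / 2 : ℝ), mul_assoc]
      refine mul_le_mul_of_nonneg_left ?_ (by positivity)
      linarith [(hδ' hx).2.2]
  have hzero : ∀ x ∈ Set.Ioo 0 δ, w x = 0 := by
    intro x hx
    have ht : Tendsto (fun n : ℕ => (1 / 2 : ℝ) ^ n * x ^ (1 / 2 : ℝ)) atTop (nhds 0) := by
      simpa using (tendsto_pow_atTop_nhds_zero_of_lt_one (by norm_num)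
        (by norm_num : (1 / 2 : ℝ) < 1)).mul_const (x ^ (1 / 2 : ℝ))
    exact norm_le_zero_iff.1 (ge_of_tendsto' ht fun n => hbound n x hx)
  have hp : ContinuousOn (fun x : ℝ =>
      (-(lam : ℂ) ^ 2 - 1 / 4) / (x : ℂ) ^ 2 + (q₀ x + μ ^ 2)) (Set.Ioo 0 A) := by
    refine (continuousOn_const.div (by fun_prop) fun x hx => ?_).add hQ
    exact pow_ne_zero 2 (by exact_mod_cast hx.1.ne')
  exact fun x hx => sub_eq_zero.1 (eq_zero_of_eq_zero_near_left hδ0 hp hw hzero x hx)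
end

section
/- Let f : ℂ → ℂ be entire, of exponential type (i.e. there exist a, c > 0 with |f(z)| ≤ c·e^{a|z|} for all z ∈ ℂ), and satisfy ∫_{−∞}^{∞} max(0, log|f(iy)|)/(1+y²) dy < ∞. Suppose there is a sequence (z_n)_{n∈ℕ} of pairwise distinct nonzero complex numbers with Re(z_n) ≥ 0, f(z_n) = 0 for all n, and such that the series ∑_{n} Re(z_n)/|z_n|² diverges. Then f is identically zero on ℂ. -/
namespace Cartwright

open Complex MeasureTheory Filter Topology Set ComplexConjugate

lemma sub_I_mul_ne_zero {z : ℂ} (hz : 0 < z.re) (t : ℝ) : z - I * t ≠ 0 := fun h => by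
  have := congrArg Complex.re h
  simp at this
  exact hz.ne' this

lemma hasDerivAt_div_sub_I_mul (c : ℂ) (t : ℝ) {z : ℂ} (hz : 0 < z.re) :
    HasDerivAt (fun z : ℂ => c / (z - I * t)) (-c / (z - I * t) ^ 2) z := by
  have h1 : HasDerivAt (fun z : ℂ => z - I * t) 1 z := (hasDerivAt_id z).sub_const _
  exact ((hasDerivAt_const z c).fun_div h1 (sub_I_mul_ne_zero hz t)).congr_deriv (by simp)

/-- The Cauchy transform of a density on an interval of the imaginary axis. -/
noncomputable def imagCauchy (h : ℝ → ℝ) (a b : ℝ) (z : ℂ) : ℂ :=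
  ∫ t in a..b, (h t : ℂ) / (z - I * t)

lemma continuous_div_sub_I_mul {h : ℝ → ℝ} (hc : Continuous h) {z : ℂ} (hz : 0 < z.re) :
    Continuous fun t : ℝ => (h t : ℂ) / (z - I * t) := by
  refine Continuous.div (by fun_prop) (by fun_prop) fun t => sub_I_mul_ne_zero hz t

lemma differentiableAt_imagCauchy {h : ℝ → ℝ} (hc : Continuous h) (a b : ℝ) {z : ℂ}
    (hz : 0 < z.re) : DifferentiableAt ℂ (imagCauchy h a b) z := by
  have hs : {w : ℂ | z.re / 2 < w.re} ∈ 𝓝 z :=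
    (isOpen_lt continuous_const continuous_re).mem_nhds (by simp; linarith)
  have hpos : ∀ w ∈ {w : ℂ | z.re / 2 < w.re}, 0 < w.re := fun w hw => by
    have : z.re / 2 < w.re := hw
    linarith
  refine (intervalIntegral.hasDerivAt_integral_of_dominated_loc_of_deriv_le
    (F := fun (z : ℂ) (t : ℝ) => (h t : ℂ) / (z - I * t))
    (F' := fun (z : ℂ) (t : ℝ) => -(h t : ℂ) / (z - I * t) ^ 2)
    (bound := fun t => |h t| / (z.re / 2) ^ 2) hs ?_ ?_ ?_ ?_ ?_ ?_).2.differentiableAt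
  · filter_upwards [hs] with w hw
    exact (continuous_div_sub_I_mul hc (hpos w hw)).aestronglyMeasurable
  · exact (continuous_div_sub_I_mul hc hz).intervalIntegrable _ _
  · refine Continuous.aestronglyMeasurable (Continuous.div (by fun_prop) (by fun_prop) ?_)
    exact fun t => pow_ne_zero 2 (sub_I_mul_ne_zero hz t)
  · refine Eventually.of_forall fun t _ w hw => ?_
    have hw' : z.re / 2 < w.re := hw
    have h1 : w.re ≤ ‖w - I * t‖ := by
      have := Complex.re_le_norm (w - I * t)
      simpa using this
    rw [norm_div, norm_neg, norm_pow, Complex.norm_real, Real.norm_eq_abs]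
    gcongr
    linarith
  · exact Continuous.intervalIntegrable (by fun_prop) _ _
  · exact Eventually.of_forall fun t _ w hw => hasDerivAt_div_sub_I_mul _ t (hpos w hw)

lemma re_imagCauchy {h : ℝ → ℝ} (hc : Continuous h) (a b : ℝ) {z : ℂ} (hz : 0 < z.re) :
    (imagCauchy h a b z).re = ∫ t in a..b, h t * (z.re / (z.re ^ 2 + (t - z.im) ^ 2)) := by
  have h1 := Complex.reCLM.intervalIntegral_comp_comm
    ((continuous_div_sub_I_mul hc hz).intervalIntegrable (μ := volume) a b)
  rw [imagCauchy, ← Complex.reCLM_apply, ← h1]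
  refine intervalIntegral.integral_congr fun t _ => ?_
  simp only [Complex.reCLM_apply, Complex.div_re, Complex.normSq_apply]
  simp
  ring

lemma continuous_poissonKernel {x : ℝ} (hx : 0 < x) (y : ℝ) :
    Continuous fun t : ℝ => x / (x ^ 2 + (t - y) ^ 2) :=
  Continuous.div (by fun_prop) (by fun_prop) fun t => by positivity

lemma integral_poissonKernel {x : ℝ} (hx : 0 < x) (y η : ℝ) :
    ∫ t in (y - η)..(y + η), x / (x ^ 2 + (t - y) ^ 2) = 2 * Real.arctan (η / x) := by
  have hd : ∀ t ∈ uIcc (y - η) (y + η), HasDerivAt (fun t => Real.arctan ((t - y) / x))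
      (x / (x ^ 2 + (t - y) ^ 2)) t := fun t _ => by
    have h1 := (((hasDerivAt_id t).sub_const y).div_const x).arctan
    refine h1.congr_deriv ?_
    rw [id_eq]
    field_simp
  rw [intervalIntegral.integral_eq_sub_of_hasDerivAt hd
    ((continuous_poissonKernel hx y).intervalIntegrable _ _)]
  have : (y - η - y) / x = -(η / x) := by ring
  rw [this, Real.arctan_neg]
  ring_nf

lemma eventually_le_poisson {h : ℝ → ℝ} (hc : Continuous h) (hn : ∀ t, 0 ≤ h t) {R : ℝ}
    (hR : 0 < R) : ∀ᶠ x in 𝓝[>] (0 : ℝ), ∀ y : ℝ, |y| ≤ R → h y - 1 ≤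
      1 / Real.pi * ∫ t in (-(R + 1))..(R + 1), h t * (x / (x ^ 2 + (t - y) ^ 2)) := by
  obtain ⟨M, hM⟩ := (isCompact_Icc (a := -(R + 1)) (b := R + 1)).exists_bound_of_continuousOn
    hc.continuousOn
  have hM0 : 0 ≤ M := (norm_nonneg _).trans (hM 0 ⟨by linarith, by linarith⟩)
  have huc := (isCompact_Icc (a := -(R + 1)) (b := R + 1)).uniformContinuousOn_of_continuous
    hc.continuousOn
  obtain ⟨η₀, hη₀, hη⟩ := Metric.uniformContinuousOn_iff.1 huc (1 / 2) (by norm_num)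
  set η := min (η₀ / 2) 1
  have hηpos : 0 < η := by positivity
  have hη1 : η ≤ 1 := min_le_right _ _
  have hηη : η < η₀ := (min_le_left _ _).trans_lt (by linarith)
  have hlim : Tendsto (fun x : ℝ => 2 / Real.pi * Real.arctan (η / x)) (𝓝[>] 0) (𝓝 1) := by
    have h1 : Tendsto (fun x : ℝ => η / x) (𝓝[>] 0) atTop := by
      simpa [div_eq_mul_inv] using tendsto_inv_nhdsGT_zero.const_mul_atTop hηpos
    have h2 := ((tendsto_nhds_of_tendsto_nhdsWithin Real.tendsto_arctan_atTop).comp h1).const_mul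
      (2 / Real.pi)
    have h3 : 2 / Real.pi * (Real.pi / 2) = 1 := by field_simp
    rwa [h3] at h2
  have hlt : 1 - 1 / (2 * (M + 1)) < 1 := by
    have : 0 < 1 / (2 * (M + 1)) := by positivity
    linarith
  filter_upwards [hlim.eventually_const_lt hlt, self_mem_nhdsWithin] with x hq hx y hy
  have hx : 0 < x := hx
  have hy' := abs_le.1 hy
  set q := 2 / Real.pi * Real.arctan (η / x) with hq_def
  have hk := continuous_poissonKernel hx y
  have hnn : ∀ t, 0 ≤ h t * (x / (x ^ 2 + (t - y) ^ 2)) := fun t =>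
    mul_nonneg (hn t) (by positivity)
  have hyI : y ∈ Icc (-(R + 1)) (R + 1) := ⟨by linarith, by linarith⟩
  have hyM : h y ≤ M := (le_abs_self _).trans (hM y hyI)
  rcases le_or_gt (h y) 1 with h1 | h1
  · have : 0 ≤ 1 / Real.pi * ∫ t in (-(R + 1))..(R + 1), h t * (x / (x ^ 2 + (t - y) ^ 2)) :=
      mul_nonneg (by positivity)
        (intervalIntegral.integral_nonneg (by linarith) fun t _ => hnn t)
    linarith
  have hmono : ∫ t in (y - η)..(y + η), h t * (x / (x ^ 2 + (t - y) ^ 2)) ≤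
      ∫ t in (-(R + 1))..(R + 1), h t * (x / (x ^ 2 + (t - y) ^ 2)) :=
    intervalIntegral.integral_mono_interval (by linarith) (by linarith) (by linarith)
      (Eventually.of_forall hnn) ((hc.mul hk).intervalIntegrable _ _)
  have hloc : (h y - 1 / 2) * (2 * Real.arctan (η / x)) ≤
      ∫ t in (y - η)..(y + η), h t * (x / (x ^ 2 + (t - y) ^ 2)) := by
    rw [← integral_poissonKernel hx y η, ← intervalIntegral.integral_const_mul]
    refine intervalIntegral.integral_mono_on (by linarith)
      ((continuous_const.mul hk).intervalIntegrable _ _) ((hc.mul hk).intervalIntegrable _ _) ?_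
    intro t ht
    have hd := hη t ⟨by linarith [ht.1], by linarith [ht.2]⟩ y hyI (by
      rw [Real.dist_eq, abs_lt]
      constructor <;> linarith [ht.1, ht.2])
    rw [Real.dist_eq, abs_lt] at hd
    exact mul_le_mul_of_nonneg_right (by linarith [hd.1]) (by positivity)
  have hfin : (h y - 1 / 2) * q ≤
      1 / Real.pi * ∫ t in (-(R + 1))..(R + 1), h t * (x / (x ^ 2 + (t - y) ^ 2)) := by
    calc (h y - 1 / 2) * q
        = 1 / Real.pi * ((h y - 1 / 2) * (2 * Real.arctan (η / x))) := by rw [hq_def]; ring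
      _ ≤ _ := mul_le_mul_of_nonneg_left (hloc.trans hmono) (by positivity)
  refine le_trans ?_ hfin
  have h2 : (h y - 1 / 2) * (1 - 1 / (2 * (M + 1))) ≤ (h y - 1 / 2) * q :=
    mul_le_mul_of_nonneg_left hq.le (by linarith)
  have h3 : (h y - 1 / 2) * (1 / (2 * (M + 1))) ≤ 1 / 2 := by
    rw [mul_one_div, div_le_iff₀ (by positivity)]
    linarith
  linarith

/-- A Möbius transformation taking the right half-plane to itself, the segment `(-iR, iR)` to the
lower half of the imaginary axis and the half-circle of radius `R` to the positive real axis. -/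
noncomputable def halfDiskMap (R : ℝ) (z : ℂ) : ℂ := (I * z + R) / (z + I * R)

lemma add_I_mul_ne_zero {z : ℂ} (hz : 0 < z.re) (t : ℝ) : z + I * t ≠ 0 := fun h => by
  have := congrArg Complex.re h
  simp at this
  exact hz.ne' this

lemma halfDiskMap_re {R : ℝ} {z : ℂ} :
    (halfDiskMap R z).re = 2 * R * z.re / normSq (z + I * R) := by
  rw [halfDiskMap, Complex.div_re, ← add_div]
  simp
  ring

lemma halfDiskMap_im {R : ℝ} {z : ℂ} :
    (halfDiskMap R z).im = (‖z‖ ^ 2 - R ^ 2) / normSq (z + I * R) := by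
  rw [halfDiskMap, Complex.div_im, ← sub_div, ← Complex.normSq_eq_norm_sq, Complex.normSq_apply z]
  simp
  ring

lemma halfDiskMap_re_pos {R : ℝ} (hR : 0 < R) {z : ℂ} (hz : 0 < z.re) :
    0 < (halfDiskMap R z).re := by
  rw [halfDiskMap_re]
  have := Complex.normSq_pos.2 (add_I_mul_ne_zero hz R)
  positivity

/-- A holomorphic function whose real part is the harmonic measure of the half-circle of radius `R`
in the right half-disk. -/
noncomputable def arcFun (R : ℝ) (z : ℂ) : ℂ := 1 - 2 * I / Real.pi * log (halfDiskMap R z)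

lemma differentiableAt_arcFun {R : ℝ} (hR : 0 < R) {z : ℂ} (hz : 0 < z.re) :
    DifferentiableAt ℂ (arcFun R) z := by
  have h1 : DifferentiableAt ℂ (halfDiskMap R) z :=
    DifferentiableAt.div (by fun_prop) (by fun_prop) (add_I_mul_ne_zero hz R)
  exact ((h1.clog (Or.inl (halfDiskMap_re_pos hR hz))).const_mul _).const_sub _

lemma re_arcFun (R : ℝ) (z : ℂ) :
    (arcFun R z).re = 1 + 2 / Real.pi * (halfDiskMap R z).arg := by
  have : (2 * I / Real.pi : ℂ) = ((2 / Real.pi : ℝ) : ℂ) * I := by push_cast; ring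
  rw [arcFun, this, mul_assoc, sub_re, re_ofReal_mul, I_mul_re, log_im]
  simp

lemma re_arcFun_nonneg {R : ℝ} (hR : 0 < R) {z : ℂ} (hz : 0 < z.re) : 0 ≤ (arcFun R z).re := by
  have h1 := (abs_le.1 (Complex.abs_arg_le_pi_div_two_iff.2 (halfDiskMap_re_pos hR hz).le)).1
  have h2 : 2 / Real.pi * (-(Real.pi / 2)) ≤ 2 / Real.pi * (halfDiskMap R z).arg :=
    mul_le_mul_of_nonneg_left h1 (by positivity)
  have h3 : 2 / Real.pi * (-(Real.pi / 2)) = -1 := by field_simp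
  rw [re_arcFun]
  linarith

lemma re_arcFun_of_norm_eq {R : ℝ} (hR : 0 < R) {z : ℂ} (hz : 0 < z.re) (h : ‖z‖ = R) :
    (arcFun R z).re = 1 := by
  have : (halfDiskMap R z).arg = 0 := by
    rw [Complex.arg_eq_zero_iff]
    exact ⟨(halfDiskMap_re_pos hR hz).le, by simp [halfDiskMap_im, h]⟩
  rw [re_arcFun, this]
  simp

lemma re_arcFun_ofReal_le {R x : ℝ} (hx : 0 < x) (hR : 2 * x ≤ R) :
    (arcFun R x).re ≤ 2 * x / R := by
  have hR0 : 0 < R := by linarith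
  have hre := halfDiskMap_re_pos hR0 (z := x) (by simpa)
  have harg : (halfDiskMap R x).arg = Real.arctan ((x ^ 2 - R ^ 2) / (2 * R * x)) := by
    rw [← Real.arctan_tan (x := (halfDiskMap R x).arg)]
    · rw [Complex.tan_arg, halfDiskMap_re, halfDiskMap_im]
      have := Complex.normSq_pos.2 (add_I_mul_ne_zero (z := x) (by simpa) R)
      rw [div_div_div_cancel_right₀ this.ne']
      simp
    · exact (abs_lt.1 (Complex.abs_arg_lt_pi_div_two_iff.2 (Or.inl hre))).1
    · exact (abs_lt.1 (Complex.abs_arg_lt_pi_div_two_iff.2 (Or.inl hre))).2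
  have hd : 0 < R ^ 2 - x ^ 2 := by nlinarith
  have hs : 0 < 2 * R * x / (R ^ 2 - x ^ 2) := by positivity
  have he : (x ^ 2 - R ^ 2) / (2 * R * x) = -(2 * R * x / (R ^ 2 - x ^ 2))⁻¹ := by
    rw [inv_div]; ring
  rw [re_arcFun, harg, he, Real.arctan_neg, Real.arctan_inv_of_pos hs]
  have h1 : Real.arctan (2 * R * x / (R ^ 2 - x ^ 2)) ≤ 2 * R * x / (R ^ 2 - x ^ 2) := by
    have := Real.le_tan (Real.arctan_nonneg.2 hs.le) (Real.arctan_lt_pi_div_two _)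
    rwa [Real.tan_arctan] at this
  have h2 : 2 * R * x / (R ^ 2 - x ^ 2) ≤ 3 * x / R := by
    rw [div_le_div_iff₀ hd hR0]
    have : 4 * x ^ 2 ≤ R ^ 2 := by nlinarith
    nlinarith
  have h3 : 1 + 2 / Real.pi * -(Real.pi / 2 - Real.arctan (2 * R * x / (R ^ 2 - x ^ 2))) =
      2 / Real.pi * Real.arctan (2 * R * x / (R ^ 2 - x ^ 2)) := by field_simp; ring
  rw [h3]
  calc _ ≤ 2 / Real.pi * (3 * x / R) := by gcongr; exact h1.trans h2
    _ ≤ 2 / 3 * (3 * x / R) := by gcongr; exact Real.pi_gt_three.le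
    _ = 2 * x / R := by ring

/-- A function of exponential type in the right half-plane is bounded at points of the real axis by
the Poisson integral of its logarithm and its type; the constant `c` does not enter. -/
lemma norm_ofReal_le_of_exponentialType {g : ℂ → ℂ} (hg : Differentiable ℂ g) {a c : ℝ}
    (ha : 0 < a) (hc : 0 < c) (hb : ∀ z : ℂ, 0 ≤ z.re → ‖g z‖ ≤ c * Real.exp (a * ‖z‖))
    {h : ℝ → ℝ} (hh : Continuous h) (hn : ∀ t, 0 ≤ h t)
    (hgh : ∀ t : ℝ, ‖g (I * t)‖ ≤ Real.exp (h t)) {x : ℝ} (hx : 0 < x)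
    (hi : Integrable fun t : ℝ => h t * (x / (x ^ 2 + t ^ 2))) :
    ‖g x‖ ≤ 2 * Real.exp (1 + 1 / Real.pi * (∫ t, h t * (x / (x ^ 2 + t ^ 2))) +
      (a + 1) * (2 * x)) := by
  set R : ℝ := 2 * x + c with hR_def
  have hR : 0 < R := by positivity
  obtain ⟨δ₀, hδ₀, hδu⟩ := Metric.uniformContinuousOn_iff.1
    ((isCompact_closedBall (0 : ℂ) R).uniformContinuousOn_of_continuous hg.continuous.continuousOn)
    1 one_pos
  obtain ⟨δ, hP, hδpos, hδx, hδδ⟩ := ((eventually_le_poisson hh hn hR).and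
    ((eventually_mem_nhdsWithin (a := (0 : ℝ)) (s := Ioi 0)).and
    ((eventually_nhdsWithin_of_eventually_nhds (eventually_lt_nhds hx)).and
    (eventually_nhdsWithin_of_eventually_nhds (eventually_lt_nhds hδ₀))))).exists
  set M : ℝ := (a + 1) * R with hM_def
  have hM : 0 ≤ M := by positivity
  set H := imagCauchy h (-(R + 1)) (R + 1) with hH
  have hHre : ∀ z : ℂ, 0 < z.re → 0 ≤ (H z).re := fun z hz => by
    rw [hH, re_imagCauchy hh _ _ hz]
    exact intervalIntegral.integral_nonneg (by linarith) fun t _ =>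
      mul_nonneg (hn t) (by positivity)
  set E : ℂ → ℂ := fun z => -(((1 / Real.pi : ℝ) : ℂ) * H z + (M : ℂ) * arcFun R z) with hE
  have hEre : ∀ z, (E z).re = -(1 / Real.pi * (H z).re + M * (arcFun R z).re) := fun z => by
    simp only [hE, neg_re, add_re, re_ofReal_mul]
  set Φ : ℂ → ℂ := fun z => g z * exp (E z) with hΦ
  have hΦn : ∀ z, ‖Φ z‖ = ‖g z‖ * Real.exp (E z).re := fun z => by
    rw [hΦ, norm_mul, Complex.norm_exp]
  set U : Set ℂ := {z | δ < z.re} ∩ Metric.ball 0 R with hU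
  have hUo : IsOpen U := (isOpen_lt continuous_const continuous_re).inter Metric.isOpen_ball
  have hUc : closure U ⊆ {z | δ ≤ z.re} ∩ Metric.closedBall 0 R :=
    closure_minimal (inter_subset_inter (fun z (hz : δ < z.re) => show δ ≤ z.re from hz.le)
      Metric.ball_subset_closedBall)
      ((isClosed_le continuous_const continuous_re).inter Metric.isClosed_closedBall)
  have hd : DifferentiableOn ℂ Φ (closure U) := fun z hz => by
    have hz' : 0 < z.re := hδpos.trans_le (hUc hz).1
    refine DifferentiableAt.differentiableWithinAt ((hg z).mul (DifferentiableAt.cexp ?_))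
    exact (((differentiableAt_imagCauchy hh _ _ hz').const_mul _).add
      ((differentiableAt_arcFun hR hz').const_mul _)).neg
  have hfr : ∀ z ∈ frontier U, ‖Φ z‖ ≤ 2 * Real.exp 1 := fun z hz => by
    rw [hUo.frontier_eq] at hz
    obtain ⟨hz1, hz2⟩ := hUc hz.1
    have hz1 : δ ≤ z.re := hz1
    have hz2 : ‖z‖ ≤ R := by simpa using hz2
    have hzre : 0 < z.re := hδpos.trans_le hz1
    have hV := re_arcFun_nonneg hR hzre
    have hH0 := hHre z hzre
    rw [hΦn, hEre]
    rcases hz2.lt_or_eq with hlt | heq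
    · have hzδ : z.re = δ := by
        refine le_antisymm (not_lt.1 fun h' => hz.2 ⟨h', by simpa using hlt⟩) hz1
      have hy : |z.im| ≤ R := (abs_im_le_norm z).trans hz2
      have h1 := hP z.im hy
      rw [← hzδ, ← re_imagCauchy hh _ _ hzre, ← hH] at h1
      have h2 : ‖g z‖ ≤ 2 * Real.exp (h z.im) := by
        have hdist := hδu z (by simpa using hz2) (I * z.im) (by simpa using hy) (by
          have : z - I * z.im = (δ : ℂ) := by
            rw [← hzδ]
            apply Complex.ext <;> simp
          rw [dist_eq_norm, this, norm_real, Real.norm_eq_abs, abs_of_pos hδpos]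
          exact hδδ)
        rw [dist_eq_norm] at hdist
        have h3 := norm_le_norm_add_norm_sub' (g z) (g (I * z.im))
        have h4 := hgh z.im
        have h5 := Real.one_le_exp (hn z.im)
        linarith
      calc _ ≤ 2 * Real.exp (h z.im) *
              Real.exp (-(1 / Real.pi * (H z).re + M * (arcFun R z).re)) := by
            gcongr
        _ = 2 * Real.exp (h z.im + -(1 / Real.pi * (H z).re + M * (arcFun R z).re)) := by
            rw [Real.exp_add]; ring
        _ ≤ 2 * Real.exp 1 := by
            gcongr
            nlinarith [mul_nonneg hM hV]
    · rw [re_arcFun_of_norm_eq hR hzre heq]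
      have h1 : ‖g z‖ ≤ Real.exp M := by
        have hcR : c ≤ Real.exp R := by
          have := Real.add_one_le_exp R
          linarith
        calc ‖g z‖ ≤ c * Real.exp (a * R) := heq ▸ hb z hzre.le
          _ ≤ Real.exp R * Real.exp (a * R) := by gcongr
          _ = Real.exp M := by rw [← Real.exp_add, hM_def]; ring_nf
      have hpi : 0 ≤ 1 / Real.pi * (H z).re := by positivity
      calc _ ≤ Real.exp M * Real.exp (-(1 / Real.pi * (H z).re + M * 1)) := by gcongr
        _ = Real.exp (-(1 / Real.pi * (H z).re)) := by rw [← Real.exp_add]; ring_nf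
        _ ≤ 1 := Real.exp_le_one_iff.2 (by linarith)
        _ ≤ 2 * Real.exp 1 := by
          have := Real.add_one_le_exp 1
          linarith
  have hxU : (x : ℂ) ∈ U := by
    refine ⟨by simpa using hδx, ?_⟩
    simp only [Metric.mem_ball, dist_zero_right, norm_real, Real.norm_eq_abs, abs_of_pos hx]
    linarith
  have hmax := Complex.norm_le_of_forall_mem_frontier_norm_le
    (Metric.isBounded_ball.subset inter_subset_right) hd.diffContOnCl hfr (subset_closure hxU)
  rw [hΦn, hEre, Real.exp_neg, ← div_eq_mul_inv, div_le_iff₀ (Real.exp_pos _), mul_assoc,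
    ← Real.exp_add] at hmax
  refine hmax.trans ?_
  have h1 : (H x).re ≤ ∫ t, h t * (x / (x ^ 2 + t ^ 2)) := by
    rw [hH, re_imagCauchy hh _ _ (by simpa), intervalIntegral.integral_of_le (by linarith)]
    simp only [ofReal_re, ofReal_im, sub_zero]
    exact setIntegral_le_integral hi
      (Eventually.of_forall fun t => mul_nonneg (hn t) (by positivity))
  have h2 : M * (arcFun R x).re ≤ (a + 1) * (2 * x) := by
    calc _ ≤ M * (2 * x / R) := by
          gcongr
          exact re_arcFun_ofReal_le hx (by linarith)
      _ = _ := by rw [hM_def]; field_simp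
  have h3 : 1 / Real.pi * (H x).re ≤ 1 / Real.pi * ∫ t, h t * (x / (x ^ 2 + t ^ 2)) := by gcongr
  exact mul_le_mul_of_nonneg_left (Real.exp_le_exp.2 (by linarith)) zero_le_two

/-- Reflecting one zero in the right half-plane across the imaginary axis. -/
lemma exists_reflect_zero {g : ℂ → ℂ} (hg : Differentiable ℂ g) {a c : ℝ} (ha : 0 < a) (hc : 0 < c)
    (hb : ∀ z : ℂ, 0 ≤ z.re → ‖g z‖ ≤ c * Real.exp (a * ‖z‖)) {ζ : ℂ} (hζ : g ζ = 0) :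
    ∃ G : ℂ → ℂ, ∃ C : ℝ, Differentiable ℂ G ∧ 0 < C ∧
      (∀ z : ℂ, 0 ≤ z.re → ‖G z‖ ≤ C * Real.exp (a * ‖z‖)) ∧
      ∀ z, G z * (z - ζ) = g z * (z + conj ζ) := by
  have hds : Differentiable ℂ (dslope g ζ) := by
    rw [← differentiableOn_univ]
    exact (Complex.differentiableOn_dslope univ_mem).2 hg.differentiableOn
  have hmul : ∀ z, (z - ζ) * dslope g ζ z = g z := fun z => by
    have := sub_smul_dslope g ζ z
    rwa [hζ, sub_zero, smul_eq_mul] at this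
  have hG : Differentiable ℂ fun z => (z + conj ζ) * dslope g ζ z :=
    (differentiable_id.add_const _).mul hds
  have hrel : ∀ z, (z + conj ζ) * dslope g ζ z * (z - ζ) = g z * (z + conj ζ) := fun z => by
    rw [← hmul z]; ring
  obtain ⟨K, hK⟩ := (isCompact_closedBall (0 : ℂ) (3 * ‖ζ‖)).exists_bound_of_continuousOn
    hG.continuous.continuousOn
  have hK0 : 0 ≤ K := (norm_nonneg _).trans (hK 0 (by simp))
  refine ⟨fun z => (z + conj ζ) * dslope g ζ z, 2 * c + K, hG, by positivity, fun z hz => ?_, hrel⟩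
  have he : 1 ≤ Real.exp (a * ‖z‖) := Real.one_le_exp (by positivity)
  rcases le_or_gt ‖z‖ (3 * ‖ζ‖) with hle | hlt
  · calc _ ≤ K := hK z (by simpa using hle)
      _ ≤ (2 * c + K) * 1 := by linarith
      _ ≤ _ := by gcongr
  · have h1 : ‖z + conj ζ‖ ≤ ‖z‖ + ‖ζ‖ := by simpa using norm_add_le z (conj ζ)
    have h2 : ‖z‖ - ‖ζ‖ ≤ ‖z - ζ‖ := norm_sub_norm_le z ζ
    have hpos : 0 < ‖z - ζ‖ := by linarith [norm_nonneg ζ]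
    have h3 := congrArg norm (hrel z)
    rw [norm_mul _ (z - ζ), norm_mul (g z)] at h3
    have h4 : ‖(z + conj ζ) * dslope g ζ z‖ ≤ 2 * ‖g z‖ := by
      refine le_of_mul_le_mul_right ?_ hpos
      rw [h3]
      nlinarith [norm_nonneg (g z)]
    have h5 := hb z hz
    nlinarith [mul_nonneg hK0 (zero_le_one.trans he)]

lemma add_conj_ne_zero {x : ℝ} (hx : 0 < x) {ζ : ℂ} (hζ : 0 ≤ ζ.re) : (x : ℂ) + conj ζ ≠ 0 :=
  fun h => by
    have := congrArg Complex.re h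
    simp at this
    linarith

lemma exists_reflect_zeros {f : ℂ → ℂ} (hf : Differentiable ℂ f) {a c : ℝ} (ha : 0 < a)
    (hc : 0 < c) (hb : ∀ z : ℂ, 0 ≤ z.re → ‖f z‖ ≤ c * Real.exp (a * ‖z‖)) {z : ℕ → ℂ}
    (hinj : Function.Injective z) (hre : ∀ n, 0 ≤ (z n).re) (hzero : ∀ n, f (z n) = 0) (N : ℕ) :
    ∃ g : ℂ → ℂ, ∃ C : ℝ, Differentiable ℂ g ∧ 0 < C ∧
      (∀ w : ℂ, 0 ≤ w.re → ‖g w‖ ≤ C * Real.exp (a * ‖w‖)) ∧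
      (∀ t : ℝ, ‖g (I * t)‖ ≤ ‖f (I * t)‖) ∧ (∀ n, N ≤ n → g (z n) = 0) ∧
      ∀ x : ℝ, 0 < x →
        ‖f x‖ = ‖g x‖ * ∏ n ∈ Finset.range N, ‖(x : ℂ) - z n‖ / ‖(x : ℂ) + conj (z n)‖ := by
  induction N with
  | zero => exact ⟨f, c, hf, hc, hb, fun _ => le_rfl, fun n _ => hzero n, fun x _ => by simp⟩
  | succ N ih =>
    obtain ⟨g, C, hg, hC, hgb, hgI, hgz, hgx⟩ := ih
    obtain ⟨G, C', hG, hC', hGb, hGg⟩ := exists_reflect_zero hg ha hC hgb (hgz N le_rfl)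
    have himag : ∀ t : ℝ, I * t ≠ z N → ‖G (I * t)‖ ≤ ‖g (I * t)‖ := fun t ht => by
      have h1 : ‖I * t + conj (z N)‖ = ‖I * t - z N‖ := by
        rw [← Complex.norm_conj (I * t - z N), ← norm_neg]
        congr 1
        simp
        ring
      have h2 := congrArg norm (hGg (I * t))
      rw [norm_mul, norm_mul, h1] at h2
      exact (mul_right_cancel₀ (norm_ne_zero_iff.2 (sub_ne_zero.2 ht)) h2).le
    refine ⟨G, C', hG, hC', hGb, fun t => ?_, fun n hn => ?_, fun x hx => ?_⟩
    · refine le_trans ?_ (hgI t)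
      have hcl : IsClosed {t : ℝ | ‖G (I * t)‖ ≤ ‖g (I * t)‖} :=
        isClosed_le (hG.continuous.comp (by fun_prop)).norm (hg.continuous.comp (by fun_prop)).norm
      have hden : Dense ({(z N).im}ᶜ : Set ℝ) := dense_compl_singleton _
      have hsub : ({(z N).im}ᶜ : Set ℝ) ⊆ {t : ℝ | ‖G (I * t)‖ ≤ ‖g (I * t)‖} := fun s hs =>
        himag s fun h => hs (by rw [mem_singleton_iff, ← h]; simp)
      exact hcl.closure_subset_iff.2 hsub (hden t)
    · have h1 := hGg (z n)
      rw [hgz n (by omega), zero_mul] at h1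
      exact (mul_eq_zero.1 h1).resolve_right (sub_ne_zero.2 fun h => by
        have := hinj h
        omega)
    · have h1 := congrArg norm (hGg x)
      rw [norm_mul, norm_mul] at h1
      have h2 := norm_pos_iff.2 (add_conj_ne_zero hx (hre N))
      rw [Finset.prod_range_succ, hgx x hx, mul_comm (∏ _ ∈ _, _), ← mul_assoc, mul_div_assoc',
        h1, mul_div_assoc, div_self h2.ne', mul_one]

lemma norm_sub_div_norm_add_conj_le {x : ℝ} (hx : 0 < x) {ζ : ℂ} (hζ : 0 ≤ ζ.re) :
    ‖(x : ℂ) - ζ‖ / ‖(x : ℂ) + conj ζ‖ ≤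
      Real.exp (-(2 * x * (ζ.re / ‖(x : ℂ) + conj ζ‖ ^ 2))) := by
  have hq := norm_pos_iff.2 (add_conj_ne_zero hx hζ)
  have hsq : ‖(x : ℂ) - ζ‖ ^ 2 = ‖(x : ℂ) + conj ζ‖ ^ 2 - 4 * x * ζ.re := by
    rw [← Complex.normSq_eq_norm_sq, ← Complex.normSq_eq_norm_sq, Complex.normSq_apply,
      Complex.normSq_apply]
    simp
    ring
  refine (sq_le_sq₀ (by positivity) (Real.exp_pos _).le).1 ?_
  rw [← Real.exp_nat_mul, div_pow, hsq, sub_div, div_self (by positivity)]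
  have := Real.add_one_le_exp (-(4 * x * ζ.re / ‖(x : ℂ) + conj ζ‖ ^ 2))
  calc _ ≤ _ := by linarith
    _ ≤ _ := this
    _ = _ := by congr 1; push_cast; ring

lemma summable_re_div_norm_sq {f : ℂ → ℂ} (hf : Differentiable ℂ f)
    (hexp : ∃ a c : ℝ, 0 < a ∧ 0 < c ∧ ∀ z : ℂ, ‖f z‖ ≤ c * Real.exp (a * ‖z‖))
    (hint : Integrable
      (fun y : ℝ => max 0 (Real.log ‖f (I * y)‖) / (1 + y ^ 2)))
    {z : ℕ → ℂ} (hinj : Function.Injective z) (hz0 : ∀ n, z n ≠ 0)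
    (hre : ∀ n, 0 ≤ (z n).re) (hzero : ∀ n, f (z n) = 0) {w : ℂ} (hw : f w ≠ 0) :
    Summable fun n : ℕ => (z n).re / ‖z n‖ ^ 2 := by
  have han : AnalyticOnNhd ℂ f univ := hf.differentiableOn.analyticOnNhd isOpen_univ
  have hne : ∀ p : ℂ, ∀ᶠ q in 𝓝[≠] p, f q ≠ 0 := fun p =>
    (han p (mem_univ p)).eventually_eq_zero_or_eventually_ne_zero.resolve_left fun h0 =>
      hw (congrFun (han.eq_of_eventuallyEq (g := fun _ => 0) analyticOnNhd_const h0) w)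
  obtain ⟨r, hr, hrz⟩ : ∃ r > 0, ∀ n, r ≤ ‖z n‖ := by
    obtain ⟨r, hr, hsub⟩ := Metric.eventually_nhds_iff.1 (eventually_nhdsWithin_iff.1 (hne 0))
    exact ⟨r, hr, fun n => not_lt.1 fun h => hsub (by simpa using h) (hz0 n) (hzero n)⟩
  obtain ⟨x, hx, hfx⟩ : ∃ x : ℝ, 0 < x ∧ f x ≠ 0 := by
    have ht : Tendsto (fun x : ℝ => (x : ℂ)) (𝓝[>] 0) (𝓝[≠] ((0 : ℝ) : ℂ)) :=
      tendsto_nhdsWithin_of_tendsto_nhds_of_eventually_within _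
        (continuous_ofReal.continuousAt.tendsto.mono_left nhdsWithin_le_nhds)
        (by filter_upwards [self_mem_nhdsWithin] with x hx
            exact ofReal_injective.ne (mem_Ioi.1 hx).ne')
    obtain ⟨x, h1, h2⟩ := ((ht.eventually (hne _)).and self_mem_nhdsWithin).exists
    exact ⟨x, h2, h1⟩
  obtain ⟨a, c, ha, hc, hb⟩ := hexp
  set h : ℝ → ℝ := fun t => max 0 (Real.log ‖f (I * t)‖) with hh
  have hcont : Continuous h :=
    Real.continuous_posLog.comp (hf.continuous.comp (by fun_prop)).norm
  have hn : ∀ t, 0 ≤ h t := fun t => le_max_left _ _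
  have hfh : ∀ t : ℝ, ‖f (I * t)‖ ≤ Real.exp (h t) := fun t =>
    (Real.le_exp_log _).trans (Real.exp_le_exp.2 (le_max_right _ _))
  have hi : Integrable fun t : ℝ => h t * (x / (x ^ 2 + t ^ 2)) := by
    refine (hint.const_mul (x + 1 / x)).mono' (Continuous.aestronglyMeasurable ?_)
      (Eventually.of_forall fun t => ?_)
    · exact hcont.mul (by simpa using continuous_poissonKernel hx 0)
    · rw [Real.norm_of_nonneg (mul_nonneg (hn t) (by positivity))]
      have h1 : x / (x ^ 2 + t ^ 2) ≤ (x + 1 / x) / (1 + t ^ 2) := by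
        rw [div_le_div_iff₀ (by positivity) (by positivity)]
        have : (x + 1 / x) * (x ^ 2 + t ^ 2) = x ^ 3 + x * t ^ 2 + x + t ^ 2 / x := by
          field_simp
          ring
        rw [this]
        have : 0 ≤ x ^ 3 + t ^ 2 / x := by positivity
        linarith
      calc _ ≤ h t * ((x + 1 / x) / (1 + t ^ 2)) := mul_le_mul_of_nonneg_left h1 (hn t)
        _ = _ := by rw [hh]; ring
  set B := 2 * Real.exp (1 + 1 / Real.pi * (∫ t, h t * (x / (x ^ 2 + t ^ 2))) +
      (a + 1) * (2 * x))
  have hB : 0 < B := by positivity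
  have hfx' : 0 < ‖f x‖ := norm_pos_iff.2 hfx
  have hsum : ∀ N, ∑ n ∈ Finset.range N, 2 * x * ((z n).re / ‖(x : ℂ) + conj (z n)‖ ^ 2) ≤
      Real.log (B / ‖f x‖) := fun N => by
    obtain ⟨g, C, hg, hC, hgb, hgI, -, hgx⟩ :=
      exists_reflect_zeros hf ha hc (fun z _ => hb z) hinj hre hzero N
    have h1 : ‖g x‖ ≤ B := norm_ofReal_le_of_exponentialType hg ha hC hgb hcont hn
      (fun t => (hgI t).trans (hfh t)) hx hi
    have h2 : ‖f x‖ ≤ B * Real.exp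
        (-∑ n ∈ Finset.range N, 2 * x * ((z n).re / ‖(x : ℂ) + conj (z n)‖ ^ 2)) := by
      rw [hgx x hx, ← Finset.sum_neg_distrib, Real.exp_sum]
      exact mul_le_mul h1 (Finset.prod_le_prod (fun _ _ => by positivity)
        fun n _ => norm_sub_div_norm_add_conj_le hx (hre n))
        (Finset.prod_nonneg fun _ _ => by positivity) hB.le
    rw [Real.le_log_iff_exp_le (by positivity), le_div_iff₀ hfx', ← le_div_iff₀' (Real.exp_pos _),
      div_eq_mul_inv, ← Real.exp_neg]
    exact h2
  have hs := summable_of_sum_range_le (fun n => mul_nonneg (by positivity)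
    (div_nonneg (hre n) (by positivity))) hsum
  refine Summable.of_nonneg_of_le (fun n => div_nonneg (hre n) (by positivity)) (fun n => ?_)
    (hs.mul_left ((x / r + 1) ^ 2 / (2 * x)))
  have hq := norm_pos_iff.2 (add_conj_ne_zero hx (hre n))
  have hzn := norm_pos_iff.2 (hz0 n)
  have h1 : ‖(x : ℂ) + conj (z n)‖ ≤ (x / r + 1) * ‖z n‖ := by
    have h2 : ‖(x : ℂ) + conj (z n)‖ ≤ x + ‖z n‖ := by
      simpa [abs_of_pos hx] using norm_add_le (x : ℂ) (conj (z n))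
    have h3 : x ≤ x / r * ‖z n‖ := by
      rw [div_mul_eq_mul_div, le_div_iff₀ hr]
      exact mul_le_mul_of_nonneg_left (hrz n) hx.le
    linarith
  calc (z n).re / ‖z n‖ ^ 2
      ≤ (z n).re * ((x / r + 1) ^ 2 / ‖(x : ℂ) + conj (z n)‖ ^ 2) := by
        rw [div_eq_mul_inv]
        refine mul_le_mul_of_nonneg_left ?_ (hre n)
        rw [inv_eq_one_div, div_le_div_iff₀ (by positivity) (by positivity), one_mul, ← mul_pow]
        gcongr
    _ = _ := by field_simp

end Cartwright

/-- Uniqueness theorem for the Cartwright class: an entire function of exponential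
type with `∫ log⁺|f(iy)|/(1+y²) dy < ∞`, vanishing on a sequence of pairwise distinct
nonzero points `z_n` with `Re z_n ≥ 0` and `∑ Re(z_n)/|z_n|² = ∞`, is identically zero. -/
theorem stmt10 (f : ℂ → ℂ) (hf : Differentiable ℂ f)
    (hexp : ∃ a c : ℝ, 0 < a ∧ 0 < c ∧ ∀ z : ℂ, ‖f z‖ ≤ c * Real.exp (a * ‖z‖))
    (hint : MeasureTheory.Integrable
      (fun y : ℝ => max 0 (Real.log ‖f (Complex.I * y)‖) / (1 + y ^ 2)))
    (z : ℕ → ℂ) (hinj : Function.Injective z) (hz0 : ∀ n, z n ≠ 0)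
    (hre : ∀ n, 0 ≤ (z n).re) (hzero : ∀ n, f (z n) = 0)
    (hdiv : ¬ Summable (fun n : ℕ => (z n).re / ‖z n‖ ^ 2)) :
    ∀ w : ℂ, f w = 0 := by
  by_contra! ⟨w, hw⟩
  exact hdiv (Cartwright.summable_re_div_norm_sq hf hexp hint hinj hz0 hre hzero hw)
end

section
/- Let a, b : ℝ → ℝ be continuously differentiable, let I ⊆ ℝ be an open interval, and let x, y, p_x, p_y : I → ℝ be differentiable functions with a(x(t)) − b(y(t)) > 0 for all t ∈ I, satisfying the Hamiltonian system x'(t) = 2p_x(t)/(a(x(t))−b(y(t))), y'(t) = 2p_y(t)/(a(x(t))−b(y(t))), p_x'(t) = H(t)·a'(x(t))/(a(x(t))−b(y(t))), p_y'(t) = −H(t)·b'(y(t))/(a(x(t))−b(y(t))), where H(t) = (p_x(t)² + p_y(t)²)/(a(x(t))−b(y(t))). Then the function S(t) = (b(y(t))·p_x(t)² + a(x(t))·p_y(t)²)/(a(x(t))−b(y(t))) is constant on I. -/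
/-- The function `S = (b(y)p_x² + a(x)p_y²)/(a(x)−b(y))` is a first integral of the
Hamiltonian flow of `H = (p_x²+p_y²)/(a(x)−b(y))` on a Liouville surface. -/
theorem stmt13 (a b : ℝ → ℝ) (ha : ContDiff ℝ 1 a) (hb : ContDiff ℝ 1 b)
    (α β : ℝ) (x y px py : ℝ → ℝ)
    (hpos : ∀ t ∈ Set.Ioo α β, 0 < a (x t) - b (y t))
    (H : ℝ → ℝ)
    (hH : ∀ t, H t = (px t ^ 2 + py t ^ 2) / (a (x t) - b (y t)))
    (hx : ∀ t ∈ Set.Ioo α β, HasDerivAt x (2 * px t / (a (x t) - b (y t))) t)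
    (hy : ∀ t ∈ Set.Ioo α β, HasDerivAt y (2 * py t / (a (x t) - b (y t))) t)
    (hpx : ∀ t ∈ Set.Ioo α β,
      HasDerivAt px (H t * deriv a (x t) / (a (x t) - b (y t))) t)
    (hpy : ∀ t ∈ Set.Ioo α β,
      HasDerivAt py (-(H t * deriv b (y t) / (a (x t) - b (y t)))) t) :
    ∀ s ∈ Set.Ioo α β, ∀ t ∈ Set.Ioo α β,
      (b (y s) * px s ^ 2 + a (x s) * py s ^ 2) / (a (x s) - b (y s)) =
        (b (y t) * px t ^ 2 + a (x t) * py t ^ 2) / (a (x t) - b (y t)) := by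
  have hS : ∀ t ∈ Set.Ioo α β, HasDerivAt
      (fun t => (b (y t) * px t ^ 2 + a (x t) * py t ^ 2) / (a (x t) - b (y t))) 0 t := by
    intro t ht
    have hD := (hpos t ht).ne'
    have hax := ((ha.differentiable one_ne_zero) (x t)).hasDerivAt.comp t (hx t ht)
    have hby := ((hb.differentiable one_ne_zero) (y t)).hasDerivAt.comp t (hy t ht)
    have h := ((hby.mul ((hpx t ht).pow 2)).add (hax.mul ((hpy t ht).pow 2))).div
      (hax.sub hby) hD
    refine h.congr_deriv ?_
    simp only [Function.comp_apply, Pi.add_apply, Pi.mul_apply, Pi.sub_apply, Pi.pow_apply, hH]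
    field_simp
    ring
  intro s hs t ht
  exact isOpen_Ioo.is_const_of_deriv_eq_zero isPreconnected_Ioo
    (fun u hu => (hS u hu).differentiableAt.differentiableWithinAt)
    (fun u hu => (hS u hu).deriv) hs ht
end
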